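/- arXiv:2602.00281 — 10 statements merged into one kernel-verified Lean document; each statement's English description precedes it below -/
import Mathlib

section
/- The linear extended formulation is sharp: the convex hull of the mixed-integer set R equals the projection of the extended polytope P onto the original variables. Precisely, convexHull ℝ R = { (t, a, b) | ∃ z₁ z₂ ζ : ℝ, (t, a, b, z₁, z₂, ζ) ∈ P }. -/
/-- The part of the unit cube cut off by `∑ i, x i ≤ n - 1` lies in the convex hull of the binary
vectors other than the all-ones vector. -/
theorem mem_convexHull_binary_exists_eq_zero {n : ℕ} (x : Fin n → ℝ) (hx0 : ∀ i, 0 ≤ x i)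
    (hx1 : ∀ i, x i ≤ 1) (hx : ∑ i, x i ≤ (n : ℝ) - 1) :
    x ∈ convexHull ℝ {a : Fin n → ℝ | (∀ i, a i ∈ ({0, 1} : Set ℝ)) ∧ ∃ i, a i = 0} := by
  set s : ℝ := ∑ i, (1 - x i) with hs
  have hs1 : 1 ≤ s := by
    rw [hs, Finset.sum_sub_distrib]
    simp
    linarith
  have hs0 : 0 < s := by linarith
  set w : Fin n → ℝ := fun i => (1 - x i) / s with hw
  have hw0 : ∀ i, 0 ≤ w i := fun i => div_nonneg (by linarith [hx1 i]) hs0.le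
  have hw1 : ∑ i, w i = 1 := by
    rw [hw, ← Finset.sum_div, ← hs, div_self hs0.ne']
  have hwx : ∀ i, w i ≤ 1 - x i := fun i => div_le_self (by linarith [hx1 i]) hs1
  set d : Fin n → Fin n → ℝ := fun i j => if j = i then 0 else x j / (1 - w j) with hd
  have hdmem : ∀ i, d i ∈
      convexHull ℝ {a : Fin n → ℝ | (∀ i, a i ∈ ({0, 1} : Set ℝ)) ∧ ∃ i, a i = 0} := by
    intro i
    have hsub : Set.pi Set.univ (fun j : Fin n => if j = i then ({0} : Set ℝ) else {0, 1}) ⊆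
        {a : Fin n → ℝ | (∀ i, a i ∈ ({0, 1} : Set ℝ)) ∧ ∃ i, a i = 0} := by
      intro a ha
      refine ⟨fun j => ?_, i, ?_⟩
      · have := ha j (Set.mem_univ j)
        by_cases hj : j = i
        · simp only [hj, if_true, Set.mem_singleton_iff] at this ⊢
          simp [this]
        · simpa [hj] using this
      · simpa using ha i (Set.mem_univ i)
    refine convexHull_mono hsub ?_
    rw [convexHull_pi]
    intro j _
    by_cases hj : j = i
    · simp [hd, hj]
    · have h1 : x j ≤ 1 - w j := by linarith [hwx j]
      have h2 : (0 : ℝ) ≤ 1 - w j := (hx0 j).trans h1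
      simp only [hd, hj, if_false]
      rw [convexHull_pair, segment_eq_Icc zero_le_one]
      exact ⟨div_nonneg (hx0 j) h2, div_le_one_of_le₀ h1 h2⟩
  have hsum : x = ∑ i, w i • d i := by
    ext j
    have hterm : ∀ i, (w i • d i) j =
        w i * (x j / (1 - w j)) - if j = i then w i * (x j / (1 - w j)) else 0 := by
      intro i
      by_cases hj : j = i <;> simp [hd, hj]
    rw [Finset.sum_apply, Finset.sum_congr rfl fun i _ => hterm i, Finset.sum_sub_distrib,
      ← Finset.sum_mul, hw1, Finset.sum_ite_eq, if_pos (Finset.mem_univ j)]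
    by_cases h : 1 - w j = 0
    · have : x j = 0 := le_antisymm (by linarith [hwx j]) (hx0 j)
      simp [this]
    · field_simp
  rw [hsum]
  exact (convex_convexHull ℝ _).sum_mem (fun i _ => hw0 i) hw1 fun i _ => hdmem i

/-- If all `a i ≤ 1` and some entry vanishes, the sum is at most `n - 1`. -/
theorem sum_le_card_sub_one_of_exists_eq_zero {n : ℕ} (a : Fin n → ℝ) (ha : ∀ i, a i ≤ 1)
    (h : ∃ i, a i = 0) : ∑ i, a i ≤ (n : ℝ) - 1 := by
  obtain ⟨i, hi⟩ := h
  have h1 : 1 - a i ≤ ∑ j, (1 - a j) :=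
    Finset.single_le_sum (f := fun j => 1 - a j) (fun j _ => by linarith [ha j])
      (Finset.mem_univ i)
  rw [Finset.sum_sub_distrib] at h1
  simp at h1
  linarith

/-- The big-M term relaxes the bound to at least `M` as soon as one entry vanishes. -/
theorem le_sum_add_sum_bigM_of_exists_eq_zero {n : ℕ} (u a : Fin n → ℝ) (M : ℝ)
    (hu : ∀ i, 0 < u i) (hM : ∑ i, u i < M) (ha : ∀ i, a i ≤ 1) (h : ∃ i, a i = 0) :
    M ≤ ∑ i, u i + ∑ i, (M - u i) * (1 - a i) := by
  obtain ⟨i, hi⟩ := h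
  have hle : ∀ j, u j ≤ ∑ k, u k := fun j =>
    Finset.single_le_sum (fun k _ => (hu k).le) (Finset.mem_univ j)
  have h1 : (M - u i) * (1 - a i) ≤ ∑ j, (M - u j) * (1 - a j) :=
    Finset.single_le_sum (f := fun j => (M - u j) * (1 - a j))
      (fun j _ => mul_nonneg (by linarith [hle j]) (by linarith [ha j])) (Finset.mem_univ i)
  rw [hi] at h1
  linarith [hle i]

/-- For binary vectors, the big-M constraint together with `|t| ≤ M` says that `|t| ≤ ∑ i, u i`
whenever all entries are one. -/
theorem le_bigM_iff {n : ℕ} (u a : Fin n → ℝ) (M r : ℝ) (hu : ∀ i, 0 < u i)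
    (hM : ∑ i, u i < M) (ha : ∀ i, a i ∈ ({0, 1} : Set ℝ)) (hr : r ≤ M) :
    r ≤ ∑ i, u i + ∑ i, (M - u i) * (1 - a i) ↔ ((∀ i, a i = 1) → r ≤ ∑ i, u i) := by
  by_cases h : ∀ i, a i = 1
  · simp [h]
  · have h0 : ∃ i, a i = 0 := by
      push Not at h
      obtain ⟨i, hi⟩ := h
      exact ⟨i, (ha i).resolve_right hi⟩
    have ha1 : ∀ i, a i ≤ 1 := fun i => by
      rcases ha i with h | h
      · rw [h]; exact zero_le_one
      · exact le_of_eq h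
    exact ⟨fun _ h' => absurd h' h,
      fun _ => hr.trans (le_sum_add_sum_bigM_of_exists_eq_zero u a M hu hM ha1 h0)⟩

/-- The product of a binary vector's entries, described by its linearized constraints. -/
theorem exists_binary_product {n : ℕ} (a : Fin n → ℝ) (ha : ∀ i, a i ∈ ({0, 1} : Set ℝ)) :
    (∀ i, 0 ≤ a i ∧ a i ≤ 1) ∧ ∃ z : ℝ, (∀ i, z ≤ a i) ∧ ∑ i, a i - (n : ℝ) + 1 ≤ z ∧
      (z = 0 ∨ (z = 1 ∧ ∀ i, a i = 1)) := by
  have hb : ∀ i, 0 ≤ a i ∧ a i ≤ 1 := fun i => by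
    rcases ha i with h | h
    · rw [h]; norm_num
    · rw [Set.mem_singleton_iff.1 h]; norm_num
  refine ⟨hb, ?_⟩
  by_cases h : ∀ i, a i = 1
  · exact ⟨1, fun i => (h i).ge, by simp [h], Or.inr ⟨rfl, h⟩⟩
  · push Not at h
    obtain ⟨i, hi⟩ := h
    have := sum_le_card_sub_one_of_exists_eq_zero a (fun i => (hb i).2)
      ⟨i, (ha i).resolve_right hi⟩
    exact ⟨0, fun i => (hb i).1, by linarith, Or.inl rfl⟩

/-- A cube point `a` with linearized product `z` is the mixture, with weights `z` and `1 - z`, of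
the all-ones vector and a point in the hull of the other binary vectors. -/
theorem exists_residual_mem_convexHull {n : ℕ} (hn : 1 ≤ n) (a : Fin n → ℝ) (z : ℝ)
    (ha : ∀ i, 0 ≤ a i ∧ a i ≤ 1 ∧ z ≤ a i) (hz : ∑ i, a i - (n : ℝ) + 1 ≤ z) (hz1 : z ≤ 1) :
    ∃ a' ∈ convexHull ℝ {a : Fin n → ℝ | (∀ i, a i ∈ ({0, 1} : Set ℝ)) ∧ ∃ i, a i = 0},
      ∀ i, a i = z + (1 - z) * a' i := by
  have hn' : (1 : ℝ) ≤ n := by exact_mod_cast hn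
  rcases hz1.eq_or_lt with rfl | hlt
  · refine ⟨0, mem_convexHull_binary_exists_eq_zero 0 (by simp) (by simp) (by simpa), fun i => ?_⟩
    simpa using le_antisymm (ha i).2.1 (ha i).2.2
  · have hpos : 0 < 1 - z := by linarith
    refine ⟨fun i => (a i - z) / (1 - z), mem_convexHull_binary_exists_eq_zero _
      (fun i => div_nonneg (by linarith [(ha i).2.2]) hpos.le)
      (fun i => (div_le_one hpos).2 (by linarith [(ha i).2.1])) ?_, fun i => ?_⟩
    · rw [← Finset.sum_div, div_le_iff₀ hpos, Finset.sum_sub_distrib]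
      simp
      nlinarith
    · field_simp
      ring



/-- **Sharpness of the extended formulation (Theorem 1).**
The convex hull of the mixed-integer set `R` equals the projection of the
extended polytope `P` onto the original variables `(t, a, b)`. -/
theorem extended_formulation_sharp
    (p q : ℕ) (hp : 1 ≤ p) (hq : 1 ≤ q)
    (u : Fin p → ℝ) (v : Fin q → ℝ)
    (hu : ∀ i, 0 < u i) (hv : ∀ j, 0 < v j)
    (W₁ W₂ M : ℝ) (hW₁ : W₁ = ∑ i, u i) (hW₂ : W₂ = ∑ j, v j)
    (hWW : W₁ < W₂) (hWM : W₂ < M)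
    (R : Set (ℝ × (Fin p → ℝ) × (Fin q → ℝ)))
    (hR : R = {x : ℝ × (Fin p → ℝ) × (Fin q → ℝ) |
      (∀ i, x.2.1 i ∈ ({0, 1} : Set ℝ)) ∧ (∀ j, x.2.2 j ∈ ({0, 1} : Set ℝ)) ∧
      |x.1| ≤ W₁ + ∑ i, (M - u i) * (1 - x.2.1 i) ∧
      |x.1| ≤ W₂ + ∑ j, (M - v j) * (1 - x.2.2 j) ∧
      |x.1| ≤ M})
    (P : Set (ℝ × (Fin p → ℝ) × (Fin q → ℝ) × ℝ × ℝ × ℝ))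
    (hP : P = {x : ℝ × (Fin p → ℝ) × (Fin q → ℝ) × ℝ × ℝ × ℝ |
      (∀ i, 0 ≤ x.2.1 i ∧ x.2.1 i ≤ 1 ∧ x.2.2.2.1 ≤ x.2.1 i) ∧
      (∑ i, x.2.1 i) - (p : ℝ) + 1 ≤ x.2.2.2.1 ∧
      (∀ j, 0 ≤ x.2.2.1 j ∧ x.2.2.1 j ≤ 1 ∧ x.2.2.2.2.1 ≤ x.2.2.1 j) ∧
      (∑ j, x.2.2.1 j) - (q : ℝ) + 1 ≤ x.2.2.2.2.1 ∧
      0 ≤ x.2.2.2.2.2 ∧ x.2.2.2.2.2 ≤ x.2.2.2.2.1 ∧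
      x.2.2.2.2.2 ≤ 1 - x.2.2.2.1 ∧ x.2.2.2.2.1 - x.2.2.2.1 ≤ x.2.2.2.2.2 ∧
      0 ≤ x.2.2.2.1 ∧ x.2.2.2.1 ≤ 1 ∧ 0 ≤ x.2.2.2.2.1 ∧ x.2.2.2.2.1 ≤ 1 ∧
      |x.1| ≤ W₁ * x.2.2.2.1 + W₂ * x.2.2.2.2.2 + M * (1 - x.2.2.2.1 - x.2.2.2.2.2)}) :
    convexHull ℝ R =
      {y : ℝ × (Fin p → ℝ) × (Fin q → ℝ) |
        ∃ z₁ z₂ ζ : ℝ, (y.1, y.2.1, y.2.2, z₁, z₂, ζ) ∈ P} := by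
  have hR' : ∀ t a b, (t, a, b) ∈ R ↔ (∀ i, a i ∈ ({0, 1} : Set ℝ)) ∧
      (∀ j, b j ∈ ({0, 1} : Set ℝ)) ∧ ((∀ i, a i = 1) → |t| ≤ W₁) ∧
      ((∀ j, b j = 1) → |t| ≤ W₂) ∧ |t| ≤ M := by
    intro t a b
    subst hR hW₁ hW₂
    refine and_congr_right fun ha => and_congr_right fun hb => ?_
    rw [← and_assoc, ← and_assoc]
    refine and_congr_left fun ht => and_congr ?_ ?_
    · exact le_bigM_iff u a M |t| hu (hWW.trans hWM) ha ht
    · exact le_bigM_iff v b M |t| hv hWM hb ht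
  have hW₁pos : 0 < W₁ := by
    rw [hW₁]
    exact Finset.sum_pos (fun i _ => hu i) ⟨⟨0, hp⟩, Finset.mem_univ _⟩
  apply Set.Subset.antisymm
  · refine convexHull_min ?_ ?_
    · rintro ⟨t, a, b⟩ hx
      obtain ⟨ha, hb, h1, h2, h3⟩ := (hR' t a b).1 hx
      obtain ⟨hac, z₁, hz₁a, hz₁s, hz₁⟩ := exists_binary_product a ha
      obtain ⟨hbc, z₂, hz₂b, hz₂s, hz₂⟩ := exists_binary_product b hb
      refine ⟨z₁, z₂, z₂ * (1 - z₁), ?_⟩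
      rw [hP]
      refine ⟨fun i => ⟨(hac i).1, (hac i).2, hz₁a i⟩, hz₁s,
        fun j => ⟨(hbc j).1, (hbc j).2, hz₂b j⟩, hz₂s, ?_⟩
      rcases hz₁ with rfl | ⟨rfl, ha1⟩ <;> rcases hz₂ with rfl | ⟨rfl, hb1⟩
      · norm_num [h3]
      · norm_num [h2 hb1]
      · norm_num [h1 ha1]
      · norm_num [h1 ha1]
    · rintro ⟨t, a, b⟩ ⟨z₁, z₂, ζ, h⟩ ⟨t', a', b'⟩ ⟨z₁', z₂', ζ', h'⟩ c d hc hd hcd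
      rw [hP] at h h'
      obtain ⟨ha, hs, hb, hs2, h1, h2, h3, h4, h5, h6, h7, h8, h9⟩ := h
      obtain ⟨ha', hs', hb', hs2', h1', h2', h3', h4', h5', h6', h7', h8', h9'⟩ := h'
      have comb : ∀ {l r l' r' : ℝ}, l ≤ r → l' ≤ r' → c * l + d * l' ≤ c * r + d * r' :=
        fun h h' => add_le_add (mul_le_mul_of_nonneg_left h hc) (mul_le_mul_of_nonneg_left h' hd)
      obtain rfl : d = 1 - c := by linarith
      refine ⟨c * z₁ + (1 - c) * z₁', c * z₂ + (1 - c) * z₂', c * ζ + (1 - c) * ζ', ?_⟩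
      rw [hP]
      dsimp only at *
      refine ⟨fun i => ?_, ?_, fun j => ?_, ?_, ?_⟩
      · have e1 := comb (ha i).1 (ha' i).1
        have e2 := comb (ha i).2.1 (ha' i).2.1
        have e3 := comb (ha i).2.2 (ha' i).2.2
        simp only [Prod.smul_mk, Prod.mk_add_mk, Pi.add_apply, Pi.smul_apply, smul_eq_mul]
        exact ⟨by linarith, by linarith, e3⟩
      · have e := comb hs hs'
        simp only [Prod.smul_mk, Prod.mk_add_mk, Pi.add_apply, Pi.smul_apply, smul_eq_mul,
          Finset.sum_add_distrib, ← Finset.mul_sum]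
        linarith
      · have e1 := comb (hb j).1 (hb' j).1
        have e2 := comb (hb j).2.1 (hb' j).2.1
        have e3 := comb (hb j).2.2 (hb' j).2.2
        simp only [Prod.smul_mk, Prod.mk_add_mk, Pi.add_apply, Pi.smul_apply, smul_eq_mul]
        exact ⟨by linarith, by linarith, e3⟩
      · have e := comb hs2 hs2'
        simp only [Prod.smul_mk, Prod.mk_add_mk, Pi.add_apply, Pi.smul_apply, smul_eq_mul,
          Finset.sum_add_distrib, ← Finset.mul_sum]
        linarith
      · have e1 := comb h1 h1'
        have e2 := comb h2 h2'
        have e3 := comb h3 h3'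
        have e4 := comb h4 h4'
        have e5 := comb h5 h5'
        have e6 := comb h6 h6'
        have e7 := comb h7 h7'
        have e8 := comb h8 h8'
        have e9 := comb (abs_le.1 h9).1 (abs_le.1 h9').1
        have e10 := comb (abs_le.1 h9).2 (abs_le.1 h9').2
        simp only [Prod.smul_mk, Prod.mk_add_mk, smul_eq_mul]
        refine ⟨?_, ?_, ?_, ?_, ?_, ?_, ?_, ?_, abs_le.2 ⟨?_, ?_⟩⟩ <;> linarith
  · rintro ⟨t, a, b⟩ ⟨z₁, z₂, ζ, h⟩
    rw [hP] at h
    obtain ⟨ha, hs, hb, hs2, h1, h2, h3, h4, h5, h6, h7, h8, h9⟩ := h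
    dsimp only at *
    obtain ⟨a', ha', haa'⟩ := exists_residual_mem_convexHull hp a z₁ ha hs h6
    obtain ⟨b', hb', hbb'⟩ := exists_residual_mem_convexHull hq b z₂ hb hs2 h8
    have block : ∀ (B : ℝ) (A : Set (Fin p → ℝ)) (A' : Set (Fin q → ℝ)),
        (∀ r x y, |r| ≤ B → x ∈ A → y ∈ A' → (r, x, y) ∈ R) →
        ∀ r x y, |r| ≤ B → x ∈ convexHull ℝ A → y ∈ convexHull ℝ A' →
          (r, x, y) ∈ convexHull ℝ R := by
      intro B A A' hsub r x y hr hx hy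
      have hK : Set.Icc (-B) B ×ˢ (A ×ˢ A') ⊆ R := by
        rintro ⟨r, x, y⟩ ⟨hr, hx, hy⟩
        exact hsub r x y (abs_le.2 hr) hx hy
      refine convexHull_mono hK ?_
      rw [convexHull_prod, convexHull_prod]
      exact ⟨subset_convexHull ℝ _ (abs_le.1 hr), hx, hy⟩
    set T : ℝ := W₁ * z₁ + W₂ * ζ + M * (1 - z₁ - ζ) with hT
    have hTpos : 0 < T := by nlinarith
    set s : ℝ := t / T with hs_def
    have hts : t = s * T := by rw [hs_def]; field_simp
    have hs_abs : |s| ≤ 1 := by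
      rw [hs_def, abs_div, abs_of_pos hTpos]
      exact (div_le_one hTpos).2 h9
    have hscale : ∀ B : ℝ, 0 < B → |s * B| ≤ B := fun B hB => by
      rw [abs_mul, abs_of_pos hB]
      exact mul_le_of_le_one_left hB.le hs_abs
    have hW₂pos : 0 < W₂ := hW₁pos.trans hWW
    have h11 : (s * W₁, (1 : Fin p → ℝ), (1 : Fin q → ℝ)) ∈ convexHull ℝ R := by
      refine block W₁ {1} {1} ?_ _ _ _ (hscale _ hW₁pos) (by simp) (by simp)
      rintro r x y hr rfl rfl
      exact (hR' _ _ _).2 ⟨by simp, by simp, fun _ => hr, fun _ => by linarith, by linarith⟩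
    have h10 : (s * W₁, (1 : Fin p → ℝ), b') ∈ convexHull ℝ R := by
      refine block W₁ {1} _ ?_ _ _ _ (hscale _ hW₁pos) (by simp) hb'
      rintro r x y hr rfl ⟨hy, -⟩
      exact (hR' _ _ _).2 ⟨by simp, hy, fun _ => hr, fun _ => by linarith, by linarith⟩
    have h01 : (s * W₂, a', (1 : Fin q → ℝ)) ∈ convexHull ℝ R := by
      refine block W₂ _ {1} ?_ _ _ _ (hscale _ hW₂pos) ha' (by simp)
      rintro r x y hr ⟨hx, i, hi⟩ rfl
      exact (hR' _ _ _).2 ⟨hx, by simp, fun h => absurd (h i) (by simp [hi]), fun _ => hr,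
        by linarith⟩
    have h00 : (s * M, a', b') ∈ convexHull ℝ R := by
      refine block M _ _ ?_ _ _ _ (hscale _ (hW₂pos.trans hWM)) ha' hb'
      rintro r x y hr ⟨hx, i, hi⟩ ⟨hy, j, hj⟩
      exact (hR' _ _ _).2 ⟨hx, hy, fun h => absurd (h i) (by simp [hi]),
        fun h => absurd (h j) (by simp [hj]), hr⟩
    have key := (convex_convexHull ℝ R).sum_mem (t := Finset.univ)
      (w := ![z₂ - ζ, z₁ - z₂ + ζ, ζ, 1 - z₁ - ζ])
      (z := ![(s * W₁, 1, 1), (s * W₁, 1, b'), (s * W₂, a', 1), (s * M, a', b')])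
      (by
        intro i _
        fin_cases i <;> simp <;> linarith)
      (by
        simp [Fin.sum_univ_four])
      (by
        intro i _
        fin_cases i
        exacts [h11, h10, h01, h00])
    convert key using 1
    simp only [Fin.sum_univ_four, Matrix.cons_val, Prod.smul_mk, Prod.mk_add_mk, Prod.mk.injEq]
    refine ⟨?_, ?_, ?_⟩
    · rw [hts, hT]
      simp only [smul_eq_mul]
      ring
    · ext i
      simp only [Pi.add_apply, Pi.smul_apply, Pi.one_apply, smul_eq_mul]
      rw [haa' i]
      ring
    · ext j
      simp only [Pi.add_apply, Pi.smul_apply, Pi.one_apply, smul_eq_mul]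
      rw [hbb' j]
      ring
end

section
/- The convex hull of the mixed-integer set R is full-dimensional: convexHull ℝ R, viewed as a subset of ℝ × (Fin p → ℝ) × (Fin q → ℝ) ≅ ℝ^(p+q+1), has nonempty topological interior. -/
/-- The convex hull of a `0`-`1` cube is the solid unit cube, so its interior contains the
centre. -/
theorem half_mem_interior_convexHull_zero_one {ι : Type*} [Finite ι] :
    (fun _ => 1 / 2 : ι → ℝ) ∈
      interior (convexHull ℝ (Set.univ.pi fun _ : ι => ({0, 1} : Set ℝ))) := by
  rw [convexHull_pi, interior_pi_set Set.finite_univ]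
  intro i _
  rw [convexHull_pair, segment_eq_Icc zero_le_one, interior_Icc]
  norm_num

/-- The right-hand side of a big-M constraint is at least the total weight. -/
theorem le_add_sum_mul_one_sub {ι : Type*} [Fintype ι] {w a : ι → ℝ} {W M : ℝ}
    (hw : ∀ i, w i ≤ M) (ha : ∀ i, a i ∈ ({0, 1} : Set ℝ)) :
    W ≤ W + ∑ i, (M - w i) * (1 - a i) := by
  refine le_add_of_nonneg_right (Finset.sum_nonneg fun i _ => ?_)
  refine mul_nonneg (sub_nonneg.2 (hw i)) ?_
  obtain h | h : a i = 0 ∨ a i = 1 := ha i <;> simp [h]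

/-- **Proposition 1 (full-dimensionality).**
The convex hull of the mixed-integer set `R` has nonempty topological interior
in `ℝ × (Fin p → ℝ) × (Fin q → ℝ) ≅ ℝ^(p+q+1)`. -/
theorem convexHull_fullDimensional
    (p q : ℕ) (hp : 1 ≤ p) (hq : 1 ≤ q)
    (u : Fin p → ℝ) (v : Fin q → ℝ)
    (hu : ∀ i, 0 < u i) (hv : ∀ j, 0 < v j)
    (W₁ W₂ M : ℝ) (hW₁ : W₁ = ∑ i, u i) (hW₂ : W₂ = ∑ j, v j)
    (hWW : W₁ < W₂) (hWM : W₂ < M)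
    (R : Set (ℝ × (Fin p → ℝ) × (Fin q → ℝ)))
    (hR : R = {x : ℝ × (Fin p → ℝ) × (Fin q → ℝ) |
      (∀ i, x.2.1 i ∈ ({0, 1} : Set ℝ)) ∧ (∀ j, x.2.2 j ∈ ({0, 1} : Set ℝ)) ∧
      |x.1| ≤ W₁ + ∑ i, (M - u i) * (1 - x.2.1 i) ∧
      |x.1| ≤ W₂ + ∑ j, (M - v j) * (1 - x.2.2 j) ∧
      |x.1| ≤ M}) :
    (interior (convexHull ℝ R)).Nonempty := by
  have hle₁ : ∀ i, u i ≤ M := fun i => by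
    have := Finset.single_le_sum (fun k _ => (hu k).le) (Finset.mem_univ i)
    linarith
  have hle₂ : ∀ j, v j ≤ M := fun j => by
    have := Finset.single_le_sum (fun k _ => (hv k).le) (Finset.mem_univ j)
    linarith
  have hpos : 0 < W₁ := by
    rw [hW₁]
    exact Finset.sum_pos (fun i _ => hu i) ⟨⟨0, hp⟩, Finset.mem_univ _⟩
  have hsub : Set.Icc (-W₁) W₁ ×ˢ (Set.univ.pi fun _ : Fin p => ({0, 1} : Set ℝ)) ×ˢ
      (Set.univ.pi fun _ : Fin q => ({0, 1} : Set ℝ)) ⊆ R := by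
    rintro ⟨t, a, b⟩ ⟨ht, ha, hb⟩
    have ht : |t| ≤ W₁ := abs_le.2 ht
    have ha : ∀ i, a i ∈ ({0, 1} : Set ℝ) := fun i => ha i trivial
    have hb : ∀ j, b j ∈ ({0, 1} : Set ℝ) := fun j => hb j trivial
    rw [hR]
    exact ⟨ha, hb, ht.trans (le_add_sum_mul_one_sub hle₁ ha),
      (ht.trans hWW.le).trans (le_add_sum_mul_one_sub hle₂ hb),
      ht.trans (hWW.trans hWM).le⟩
  refine ⟨(0, fun _ => 1 / 2, fun _ => 1 / 2), interior_mono (convexHull_mono hsub) ?_⟩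
  rw [convexHull_prod, convexHull_prod, interior_prod_eq, interior_prod_eq,
    (convex_Icc _ _).convexHull_eq, interior_Icc]
  exact ⟨⟨neg_lt_zero.2 hpos, hpos⟩, half_mem_interior_convexHull_zero_one,
    half_mem_interior_convexHull_zero_one⟩
end

section
/- The C-PVI is facet-defining for convexHull ℝ R: every point (t, a, b) of R satisfies t ≤ W₁ + ((p : ℝ) - ∑ i, a i) * (W₂ - W₁) + ((q : ℝ) - ∑ j, b j) * (M - W₂), and there exists a family of p + q + 1 affinely independent points of R each of which satisfies this inequality with equality. -/
/-- The all-ones vector, the vectors with a single zero in the first block, and the vectors with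
a zero at `i₀` in the first block and a single zero in the second block are affinely independent,
whatever first coordinates are prepended. -/
theorem affineIndependent_complement_single {p q : ℕ} (i₀ : Fin p) (r s t : ℝ) :
    AffineIndependent ℝ (fun o : Option (Fin p ⊕ Fin q) => match o with
      | none => ((r, fun _ => 1, fun _ => 1) : ℝ × (Fin p → ℝ) × (Fin q → ℝ))
      | some (Sum.inl i) => (s, fun k => 1 - Pi.single (M := fun _ => ℝ) i 1 k, fun _ => 1)
      | some (Sum.inr j) => (t, fun k => 1 - Pi.single (M := fun _ => ℝ) i₀ 1 k,
          fun k => 1 - Pi.single (M := fun _ => ℝ) j 1 k)) := by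
  rw [affineIndependent_iff_of_fintype]
  intro w hw h
  rw [Finset.univ.weightedVSub_eq_linear_combination hw] at h
  simp only [Fintype.sum_option, Fintype.sum_sum_type] at hw h
  have hb : ∀ j, w (some (Sum.inr j)) = 0 := by
    intro j
    have := congrFun (congrArg (fun x => x.2.2) h) j
    simp [Prod.snd_sum, Finset.sum_apply, mul_sub, Pi.single_apply] at this
    linarith
  have ha : ∀ i, w (some (Sum.inl i)) = 0 := by
    intro i
    have := congrFun (congrArg (fun x => x.2.1) h) i
    simp [Prod.snd_sum, Prod.fst_sum, Finset.sum_apply, mul_sub, Pi.single_apply, hb] at this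
    simp [hb] at hw
    linarith
  rintro (_ | i | j)
  · simpa [ha, hb] using hw
  · exact ha i
  · exact hb j

/-- A `0`-`1` vector is either all ones or has at least one zero entry. -/
theorem eq_one_or_one_le_card_sub_sum {n : ℕ} {a : Fin n → ℝ}
    (h : ∀ i, a i ∈ ({0, 1} : Set ℝ)) :
    (∀ i, a i = 1) ∨ 1 ≤ (n : ℝ) - ∑ i, a i := by
  refine or_iff_not_imp_left.2 fun hne => ?_
  obtain ⟨i, hi⟩ := not_forall.1 hne
  have hi0 : a i = 0 := (h i).resolve_right hi
  have hsum : ∑ k, (1 - a k) = (n : ℝ) - ∑ k, a k := by simp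
  rw [← hsum]
  calc (1 : ℝ) = 1 - a i := by rw [hi0, sub_zero]
    _ ≤ ∑ k, (1 - a k) := Finset.single_le_sum (f := fun k => 1 - a k)
        (fun k _ => by rcases h k with hk | hk <;> simp_all) (Finset.mem_univ i)


/-- **Theorem 3 (the C-PVI is facet-defining).**
Every point of `R` satisfies the C-PVI, and there exist `p + q + 1` affinely
independent points of `R` satisfying it with equality. -/
theorem CPVI_facet_defining
    (p q : ℕ) (hp : 1 ≤ p) (hq : 1 ≤ q)
    (u : Fin p → ℝ) (v : Fin q → ℝ)
    (hu : ∀ i, 0 < u i) (hv : ∀ j, 0 < v j)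
    (W₁ W₂ M : ℝ) (hW₁ : W₁ = ∑ i, u i) (hW₂ : W₂ = ∑ j, v j)
    (hWW : W₁ < W₂) (hWM : W₂ < M)
    (R : Set (ℝ × (Fin p → ℝ) × (Fin q → ℝ)))
    (hR : R = {x : ℝ × (Fin p → ℝ) × (Fin q → ℝ) |
      (∀ i, x.2.1 i ∈ ({0, 1} : Set ℝ)) ∧ (∀ j, x.2.2 j ∈ ({0, 1} : Set ℝ)) ∧
      |x.1| ≤ W₁ + ∑ i, (M - u i) * (1 - x.2.1 i) ∧
      |x.1| ≤ W₂ + ∑ j, (M - v j) * (1 - x.2.2 j) ∧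
      |x.1| ≤ M}) :
    (∀ x ∈ R, x.1 ≤ W₁ + ((p : ℝ) - ∑ i, x.2.1 i) * (W₂ - W₁)
        + ((q : ℝ) - ∑ j, x.2.2 j) * (M - W₂)) ∧
    ∃ F : Fin (p + q + 1) → ℝ × (Fin p → ℝ) × (Fin q → ℝ),
      (∀ m, F m ∈ R ∧
        (F m).1 = W₁ + ((p : ℝ) - ∑ i, (F m).2.1 i) * (W₂ - W₁)
          + ((q : ℝ) - ∑ j, (F m).2.2 j) * (M - W₂)) ∧
      AffineIndependent ℝ F := by
  have hu_le : ∀ i, u i ≤ W₁ := fun i => hW₁ ▸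
    Finset.single_le_sum (fun k _ => (hu k).le) (Finset.mem_univ i)
  have hv_le : ∀ j, v j ≤ W₂ := fun j => hW₂ ▸
    Finset.single_le_sum (fun k _ => (hv k).le) (Finset.mem_univ j)
  have hW₁_nonneg : 0 ≤ W₁ := hW₁ ▸ Finset.sum_nonneg fun k _ => (hu k).le
  subst hR
  refine ⟨?_, ?_⟩
  · rintro ⟨t, a, b⟩ ⟨ha, hb, h₁, h₂, h₃⟩
    dsimp only at *
    have ht := le_abs_self t
    have hb_nonneg : 0 ≤ (q : ℝ) - ∑ j, b j := by
      rcases eq_one_or_one_le_card_sub_sum hb with h | h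
      · simp [h]
      · linarith
    rcases eq_one_or_one_le_card_sub_sum ha with h | h
    · simp only [h, sub_self, mul_zero, Finset.sum_const_zero] at h₁
      simp only [h, Finset.sum_const, Finset.card_univ, Fintype.card_fin, nsmul_eq_mul, mul_one,
        sub_self, zero_mul]
      nlinarith
    · rcases eq_one_or_one_le_card_sub_sum hb with h' | h'
      · simp only [h', sub_self, mul_zero, Finset.sum_const_zero] at h₂
        nlinarith
      · nlinarith
  · have e : Fin (p + q + 1) ≃ Option (Fin p ⊕ Fin q) := Fintype.equivOfCardEq (by simp)
    refine ⟨_, fun m => ?_, (affineIndependent_complement_single (q := q)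
      ⟨0, hp⟩ W₁ W₂ M).comp_embedding e.toEmbedding⟩
    have hmem : ∀ {n : ℕ} (i k : Fin n),
        1 - Pi.single (M := fun _ => ℝ) i 1 k ∈ ({0, 1} : Set ℝ) := by
      intro n i k
      by_cases h : k = i <;> simp [h]
    simp only [Function.comp_apply, Equiv.coe_toEmbedding, Set.mem_ofPred_eq]
    rcases e m with _ | i | j
    · simp [abs_of_nonneg hW₁_nonneg, hWW.le, (hWW.trans hWM).le]
    · have := hu_le i
      have hW₂_nonneg := hW₁_nonneg.trans hWW.le
      refine ⟨⟨hmem i, by simp, ?_, ?_, ?_⟩, ?_⟩ <;>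
        simp [abs_of_nonneg hW₂_nonneg, Pi.single_apply] <;> linarith
    · have := hu_le ⟨0, hp⟩
      have := hv_le j
      have hM_nonneg := hW₁_nonneg.trans (hWW.trans hWM).le
      refine ⟨⟨hmem _, hmem j, ?_, ?_, ?_⟩, ?_⟩ <;>
        simp [abs_of_nonneg hM_nonneg, Pi.single_apply] <;> linarith
end

section
/- The C-PVI is valid for the mixed-integer set R: every (t, a, b) ∈ R satisfies |t| ≤ W₁ + ((p : ℝ) - ∑ i, a i) * (W₂ - W₁) + ((q : ℝ) - ∑ j, b j) * (M - W₂). -/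
/-- A 0/1 vector is either all ones, or its entries sum to at most its length minus one. -/
theorem eq_one_or_one_le_sub_sum {n : ℕ} {c : Fin n → ℝ} (hc : ∀ i, c i ∈ ({0, 1} : Set ℝ)) :
    (∀ i, c i = 1) ∨ 1 ≤ (n : ℝ) - ∑ i, c i := by
  have hsum : (n : ℝ) - ∑ i, c i = ∑ i, (1 - c i) := by simp
  by_cases h : ∀ i, c i = 1
  · exact .inl h
  · right
    obtain ⟨i, hi⟩ := not_forall.mp h
    have hi0 : c i = 0 := (hc i).resolve_right hi
    have hle : 1 - c i ≤ ∑ j, (1 - c j) := by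
      refine Finset.single_le_sum (f := fun j => 1 - c j) (fun j _ => ?_) (Finset.mem_univ i)
      rcases hc j with hj | hj <;> simp_all
    linarith


/-- **Validity of the C-PVI.**
Every point `(t, a, b)` of the mixed-integer set `R` satisfies
`|t| ≤ W₁ + (p - ∑ a i) (W₂ - W₁) + (q - ∑ b j) (M - W₂)`. -/
theorem CPVI_valid
    (p q : ℕ) (hp : 1 ≤ p) (hq : 1 ≤ q)
    (u : Fin p → ℝ) (v : Fin q → ℝ)
    (hu : ∀ i, 0 < u i) (hv : ∀ j, 0 < v j)
    (W₁ W₂ M : ℝ) (hW₁ : W₁ = ∑ i, u i) (hW₂ : W₂ = ∑ j, v j)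
    (hWW : W₁ < W₂) (hWM : W₂ < M)
    (R : Set (ℝ × (Fin p → ℝ) × (Fin q → ℝ)))
    (hR : R = {x : ℝ × (Fin p → ℝ) × (Fin q → ℝ) |
      (∀ i, x.2.1 i ∈ ({0, 1} : Set ℝ)) ∧ (∀ j, x.2.2 j ∈ ({0, 1} : Set ℝ)) ∧
      |x.1| ≤ W₁ + ∑ i, (M - u i) * (1 - x.2.1 i) ∧
      |x.1| ≤ W₂ + ∑ j, (M - v j) * (1 - x.2.2 j) ∧
      |x.1| ≤ M}) :
    ∀ x ∈ R, |x.1| ≤ W₁ + ((p : ℝ) - ∑ i, x.2.1 i) * (W₂ - W₁)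
      + ((q : ℝ) - ∑ j, x.2.2 j) * (M - W₂) := by
  subst hR
  rintro ⟨t, a, b⟩ ⟨ha, hb, hta, htb, htM⟩
  dsimp only at *
  rcases eq_one_or_one_le_sub_sum ha with ha1 | ha1 <;>
    rcases eq_one_or_one_le_sub_sum hb with hb1 | hb1
  · simp_all
  · simp only [ha1, sub_self, mul_zero, Finset.sum_const_zero, add_zero] at hta
    simp only [ha1, Finset.sum_const, Finset.card_univ, Fintype.card_fin, nsmul_eq_mul, mul_one,
      sub_self, zero_mul, add_zero]
    nlinarith
  · simp only [hb1, sub_self, mul_zero, Finset.sum_const_zero, add_zero] at htb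
    simp only [hb1, Finset.sum_const, Finset.card_univ, Fintype.card_fin, nsmul_eq_mul, mul_one,
      sub_self, zero_mul, add_zero]
    nlinarith
  · nlinarith
end

section
/- Disjunctive decomposition of R: letting B := { (t, a, b) | ∀ i, a i ∈ ({0,1} : Set ℝ) ∧ ∀ j, b j ∈ ({0,1} : Set ℝ) } denote the points with binary a and b, one has R = (P₁ ∪ P₂ ∪ P₃) ∩ B, and the three sets P₁ ∩ B, P₂ ∩ B, P₃ ∩ B are pairwise disjoint. -/
/-- The coordinates of a binary vector lie in the unit interval. -/
theorem binary_mem_unit {n : ℕ} {a : Fin n → ℝ}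
    (ha : ∀ i, a i ∈ ({0, 1} : Set ℝ)) (i : Fin n) : 0 ≤ a i ∧ a i ≤ 1 := by
  rcases ha i with h | (h : a i = 1) <;> simp [h]

/-- A binary vector has coordinate sum at most its length minus one iff it has a zero coordinate. -/
theorem sum_le_sub_one_iff_exists_eq_zero {n : ℕ} {a : Fin n → ℝ}
    (ha : ∀ i, a i ∈ ({0, 1} : Set ℝ)) : ∑ i, a i ≤ (n : ℝ) - 1 ↔ ∃ i, a i = 0 := by
  have hsum : ∑ i, (1 - a i) = (n : ℝ) - ∑ i, a i := by simp
  constructor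
  · intro h
    by_contra! hne
    have hone : ∀ i, a i = 1 := fun i => (ha i).resolve_left (hne i)
    simp [hone] at h
    linarith
  · rintro ⟨i, hi⟩
    have hle : 1 - a i ≤ ∑ i, (1 - a i) :=
      Finset.single_le_sum (f := fun i => 1 - a i)
        (fun j _ => sub_nonneg.2 (binary_mem_unit ha j).2) (Finset.mem_univ i)
    linarith

/-- A big-M relaxation term is nonnegative at binary points. -/
theorem bigM_term_nonneg {n : ℕ} {a w : Fin n → ℝ} {M : ℝ}
    (ha : ∀ i, a i ∈ ({0, 1} : Set ℝ)) (hw : ∀ i, 0 < w i) (hM : ∑ i, w i < M) (i : Fin n) :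
    0 ≤ (M - w i) * (1 - a i) := by
  have hle : w i ≤ ∑ i, w i :=
    Finset.single_le_sum (fun j _ => (hw j).le) (Finset.mem_univ i)
  exact mul_nonneg (by linarith) (sub_nonneg.2 (binary_mem_unit ha i).2)

/-- A zero coordinate makes the right-hand side of a big-M constraint at least `M`. -/
theorem le_bigM_of_exists_eq_zero {n : ℕ} {a w : Fin n → ℝ} {M : ℝ}
    (ha : ∀ i, a i ∈ ({0, 1} : Set ℝ)) (hw : ∀ i, 0 < w i) (hM : ∑ i, w i < M)
    (h : ∃ i, a i = 0) : M ≤ ∑ i, w i + ∑ i, (M - w i) * (1 - a i) := by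
  obtain ⟨i, hi⟩ := h
  have hle : w i ≤ ∑ i, w i :=
    Finset.single_le_sum (fun j _ => (hw j).le) (Finset.mem_univ i)
  have hterm : (M - w i) * (1 - a i) ≤ ∑ i, (M - w i) * (1 - a i) :=
    Finset.single_le_sum (f := fun i => (M - w i) * (1 - a i))
      (fun j _ => bigM_term_nonneg ha hw hM j) (Finset.mem_univ i)
  rw [hi] at hterm
  linarith

/-- **Disjunctive decomposition of R.**
R = (P1 ∪ P2 ∪ P3) ∩ B where B is the set of points with binary a, b,
and the sets P1 ∩ B, P2 ∩ B, P3 ∩ B are pairwise disjoint. -/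
theorem disjunctive_decomposition
    (p q : ℕ) (hp : 1 ≤ p) (hq : 1 ≤ q)
    (u : Fin p → ℝ) (v : Fin q → ℝ)
    (hu : ∀ i, 0 < u i) (hv : ∀ j, 0 < v j)
    (W₁ W₂ M : ℝ) (hW₁ : W₁ = ∑ i, u i) (hW₂ : W₂ = ∑ j, v j)
    (hWW : W₁ < W₂) (hWM : W₂ < M)
    (P₁ P₂ P₃ : Set (ℝ × (Fin p → ℝ) × (Fin q → ℝ)))
    (hP₁ : P₁ = {x : ℝ × (Fin p → ℝ) × (Fin q → ℝ) |
      |x.1| ≤ W₁ ∧ (∀ i, x.2.1 i = 1) ∧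
      (∀ i, 0 ≤ x.2.1 i ∧ x.2.1 i ≤ 1) ∧ (∀ j, 0 ≤ x.2.2 j ∧ x.2.2 j ≤ 1)})
    (hP₂ : P₂ = {x : ℝ × (Fin p → ℝ) × (Fin q → ℝ) |
      |x.1| ≤ W₂ ∧ (∀ j, x.2.2 j = 1) ∧ (∑ i, x.2.1 i) ≤ (p : ℝ) - 1 ∧
      (∀ i, 0 ≤ x.2.1 i ∧ x.2.1 i ≤ 1) ∧ (∀ j, 0 ≤ x.2.2 j ∧ x.2.2 j ≤ 1)})
    (hP₃ : P₃ = {x : ℝ × (Fin p → ℝ) × (Fin q → ℝ) |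
      |x.1| ≤ M ∧ (∑ i, x.2.1 i) ≤ (p : ℝ) - 1 ∧ (∑ j, x.2.2 j) ≤ (q : ℝ) - 1 ∧
      (∀ i, 0 ≤ x.2.1 i ∧ x.2.1 i ≤ 1) ∧ (∀ j, 0 ≤ x.2.2 j ∧ x.2.2 j ≤ 1)})
    (R : Set (ℝ × (Fin p → ℝ) × (Fin q → ℝ)))
    (hR : R = {x : ℝ × (Fin p → ℝ) × (Fin q → ℝ) |
      (∀ i, x.2.1 i ∈ ({0, 1} : Set ℝ)) ∧ (∀ j, x.2.2 j ∈ ({0, 1} : Set ℝ)) ∧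
      |x.1| ≤ W₁ + ∑ i, (M - u i) * (1 - x.2.1 i) ∧
      |x.1| ≤ W₂ + ∑ j, (M - v j) * (1 - x.2.2 j) ∧
      |x.1| ≤ M})
    (B : Set (ℝ × (Fin p → ℝ) × (Fin q → ℝ)))
    (hB : B = {x : ℝ × (Fin p → ℝ) × (Fin q → ℝ) |
      (∀ i, x.2.1 i ∈ ({0, 1} : Set ℝ)) ∧ (∀ j, x.2.2 j ∈ ({0, 1} : Set ℝ))}) :
    R = (P₁ ∪ P₂ ∪ P₃) ∩ B ∧
    Disjoint (P₁ ∩ B) (P₂ ∩ B) ∧ Disjoint (P₁ ∩ B) (P₃ ∩ B) ∧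
    Disjoint (P₂ ∩ B) (P₃ ∩ B) := by
  subst hW₁ hW₂ hP₁ hP₂ hP₃ hR hB
  have hcases : ∀ {n : ℕ} {a : Fin n → ℝ}, (∀ i, a i ∈ ({0, 1} : Set ℝ)) →
      (∀ i, a i = 1) ∨ ∃ i, a i = 0 := by
    intro n a ha
    by_cases h : ∃ i, a i = 0
    · exact Or.inr h
    · exact Or.inl fun i => (ha i).resolve_left fun hi => h ⟨i, hi⟩
  refine ⟨?_, ?_, ?_, ?_⟩
  · ext ⟨t, a, b⟩
    simp only [Set.mem_inter_iff, Set.mem_union, Set.mem_ofPred_eq]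
    constructor
    · rintro ⟨ha, hb, h₁, h₂, hM⟩
      refine ⟨?_, ha, hb⟩
      rcases hcases ha with ha1 | ha0
      · exact Or.inl (Or.inl ⟨by simpa [ha1] using h₁, ha1, binary_mem_unit ha,
          binary_mem_unit hb⟩)
      · have hasum := (sum_le_sub_one_iff_exists_eq_zero ha).2 ha0
        rcases hcases hb with hb1 | hb0
        · exact Or.inl (Or.inr ⟨by simpa [hb1] using h₂, hb1, hasum,
            binary_mem_unit ha, binary_mem_unit hb⟩)
        · exact Or.inr
            ⟨hM, hasum, (sum_le_sub_one_iff_exists_eq_zero hb).2 hb0,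
              binary_mem_unit ha, binary_mem_unit hb⟩
    · rintro ⟨h, ha, hb⟩
      have hnonneg : 0 ≤ ∑ j, (M - v j) * (1 - b j) :=
        Finset.sum_nonneg fun j _ => bigM_term_nonneg hb hv hWM j
      refine ⟨ha, hb, ?_⟩
      rcases h with (⟨ht, ha1, -⟩ | ⟨ht, -, hasum, -⟩) | ⟨ht, hasum, hbsum, -⟩
      · exact ⟨by simpa [ha1] using ht, by linarith, by linarith⟩
      · have hMa := le_bigM_of_exists_eq_zero ha hu (hWW.trans hWM)
          ((sum_le_sub_one_iff_exists_eq_zero ha).1 hasum)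
        exact ⟨by linarith, by linarith, by linarith⟩
      · have hMa := le_bigM_of_exists_eq_zero ha hu (hWW.trans hWM)
          ((sum_le_sub_one_iff_exists_eq_zero ha).1 hasum)
        have hMb := le_bigM_of_exists_eq_zero hb hv hWM
          ((sum_le_sub_one_iff_exists_eq_zero hb).1 hbsum)
        exact ⟨ht.trans hMa, ht.trans hMb, ht⟩
  · rw [Set.disjoint_left]
    rintro x ⟨⟨-, ha1, -⟩, ha, -⟩ ⟨⟨-, -, hasum, -⟩, -⟩
    obtain ⟨i, hi⟩ := (sum_le_sub_one_iff_exists_eq_zero ha).1 hasum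
    exact zero_ne_one (hi.symm.trans (ha1 i))
  · rw [Set.disjoint_left]
    rintro x ⟨⟨-, ha1, -⟩, ha, -⟩ ⟨⟨-, hasum, -⟩, -⟩
    obtain ⟨i, hi⟩ := (sum_le_sub_one_iff_exists_eq_zero ha).1 hasum
    exact zero_ne_one (hi.symm.trans (ha1 i))
  · rw [Set.disjoint_left]
    rintro x ⟨⟨-, hb1, -⟩, -, hb⟩ ⟨⟨-, -, hbsum, -⟩, -⟩
    obtain ⟨j, hj⟩ := (sum_le_sub_one_iff_exists_eq_zero hb).1 hbsum
    exact zero_ne_one (hj.symm.trans (hb1 j))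
end

section
/- The convex hull of R equals the convex hull of the union of the three disjunct polytopes: convexHull ℝ R = convexHull ℝ (P₁ ∪ P₂ ∪ P₃). -/
/-- The binary vectors indexed by `ι`. -/
def binaryVectors (ι : Type*) : Set (ι → ℝ) :=
  {a | ∀ i, a i ∈ ({0, 1} : Set ℝ)}

/-- The binary vectors with at least one vanishing coordinate. -/
def binaryVectorsWithZero (ι : Type*) : Set (ι → ℝ) :=
  {a | a ∈ binaryVectors ι ∧ ∃ i, a i = 0}

lemma mem_Icc_of_mem_zero_one {x : ℝ} (hx : x ∈ ({0, 1} : Set ℝ)) : 0 ≤ x ∧ x ≤ 1 := by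
  rcases hx with rfl | rfl <;> norm_num

lemma mem_convexHull_zero_one {x : ℝ} (h₀ : 0 ≤ x) (h₁ : x ≤ 1) :
    x ∈ convexHull ℝ ({0, 1} : Set ℝ) := by
  rw [convexHull_pair, segment_eq_Icc zero_le_one]
  exact ⟨h₀, h₁⟩

lemma eq_one_or_mem_binaryVectorsWithZero {ι : Type*} {a : ι → ℝ}
    (ha : a ∈ binaryVectors ι) :
    a = 1 ∨ a ∈ binaryVectorsWithZero ι := by
  by_cases h : ∃ i, a i = 0
  · exact Or.inr ⟨ha, h⟩
  · push Not at h
    exact Or.inl (funext fun i => (ha i).resolve_left (h i))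

section

variable {ι : Type*} [Fintype ι]

lemma mem_convexHull_binaryVectors {a : ι → ℝ} (ha : ∀ i, 0 ≤ a i ∧ a i ≤ 1) :
    a ∈ convexHull ℝ (binaryVectors ι) := by
  have h : binaryVectors ι = Set.pi Set.univ fun _ => ({0, 1} : Set ℝ) := by
    ext a
    simp [binaryVectors]
  rw [h, convexHull_pi]
  exact fun i _ => mem_convexHull_zero_one (ha i).1 (ha i).2

lemma mem_convexHull_binaryVectorsWithZero_of_eq_zero {a : ι → ℝ}
    (ha : ∀ i, 0 ≤ a i ∧ a i ≤ 1) {k : ι} (hk : a k = 0) :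
    a ∈ convexHull ℝ (binaryVectorsWithZero ι) := by
  classical
  have hface : (Set.pi Set.univ fun i => if i = k then ({0} : Set ℝ) else {0, 1}) ⊆
      binaryVectorsWithZero ι := by
    intro x hx
    have hxk : x k = 0 := by simpa using hx k (Set.mem_univ k)
    refine ⟨fun i => ?_, k, hxk⟩
    by_cases hi : i = k
    · subst hi
      exact Or.inl hxk
    · simpa [hi] using hx i (Set.mem_univ i)
  refine convexHull_mono hface ?_
  rw [convexHull_pi]
  intro i _
  by_cases hi : i = k
  · subst hi
    simp [hk]
  · simpa only [hi, if_false] using mem_convexHull_zero_one (ha i).1 (ha i).2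

/-- The polytope `{a ∈ [0,1]^ι | ∑ a ≤ |ι| - 1}` is integral. -/
lemma mem_convexHull_binaryVectorsWithZero {a : ι → ℝ}
    (ha : ∀ i, 0 ≤ a i ∧ a i ≤ 1) (hsum : ∑ i, a i ≤ (Fintype.card ι : ℝ) - 1) :
    a ∈ convexHull ℝ (binaryVectorsWithZero ι) := by
  classical
  set s : ℝ := ∑ i, (1 - a i) with hs
  have hs₁ : 1 ≤ s := by
    simp only [hs, Finset.sum_sub_distrib, Finset.sum_const, Finset.card_univ, nsmul_eq_mul,
      mul_one]
    linarith
  have hs₀ : 0 < s := by linarith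
  let w : ι → ℝ := fun i => (1 - a i) / s
  have hw₀ : ∀ i, 0 ≤ w i := fun i => div_nonneg (by linarith [(ha i).2]) hs₀.le
  have hw_le : ∀ i, w i ≤ 1 - a i := fun i => div_le_self (by linarith [(ha i).2]) hs₁
  have hw_sum : ∑ i, w i = 1 := by
    simp only [w, ← Finset.sum_div]
    exact div_self hs₀.ne'
  let z : ι → ι → ℝ := fun k i => if i = k then 0 else a i / (1 - w i)
  have hz : ∀ k, z k ∈ convexHull ℝ (binaryVectorsWithZero ι) := by
    intro k
    refine mem_convexHull_binaryVectorsWithZero_of_eq_zero (k := k) (fun i => ?_) (by simp [z])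
    by_cases hi : i = k
    · simp [z, hi]
    · simp only [z, hi, if_false]
      have h₁ : a i ≤ 1 - w i := by linarith [hw_le i]
      exact ⟨div_nonneg (ha i).1 ((ha i).1.trans h₁), div_le_one_of_le₀ h₁ ((ha i).1.trans h₁)⟩
  have hcomb : a = ∑ k, w k • z k := by
    ext i
    have hterm : ∀ k, w k * z k i =
        w k * (a i / (1 - w i)) - if i = k then w k * (a i / (1 - w i)) else 0 := by
      intro k
      by_cases hi : i = k <;> simp [z, hi]
    simp only [Finset.sum_apply, Pi.smul_apply, smul_eq_mul, hterm, Finset.sum_sub_distrib,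
      ← Finset.sum_mul, hw_sum, Finset.sum_ite_eq, Finset.mem_univ, if_true]
    rw [← sub_mul]
    refine (mul_div_cancel_of_imp' fun h => ?_).symm
    linarith [hw_le i, (ha i).1]
  rw [hcomb]
  exact (convex_convexHull ℝ _).sum_mem (fun k _ => hw₀ k) hw_sum fun k _ => hz k

lemma sum_le_card_sub_one {a : ι → ℝ} (ha : a ∈ binaryVectorsWithZero ι) :
    ∑ i, a i ≤ (Fintype.card ι : ℝ) - 1 := by
  obtain ⟨ha, k, hk⟩ := ha
  have h := Finset.single_le_sum (f := fun i => 1 - a i)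
    (fun i _ => by linarith [(mem_Icc_of_mem_zero_one (ha i)).2]) (Finset.mem_univ k)
  simp only [hk, Finset.sum_sub_distrib, Finset.sum_const, Finset.card_univ, nsmul_eq_mul,
    mul_one] at h
  linarith

/-- Switching off a line relaxes the big-`M` constraint of its path completely. -/
lemma le_bigM_bound {u a : ι → ℝ} {M : ℝ} (hu : ∀ i, 0 < u i) (hM : ∑ i, u i ≤ M)
    (ha : a ∈ binaryVectorsWithZero ι) :
    M ≤ ∑ i, u i + ∑ i, (M - u i) * (1 - a i) := by
  obtain ⟨ha, k, hk⟩ := ha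
  have hle : ∀ i, u i ≤ ∑ i, u i := fun i =>
    Finset.single_le_sum (f := u) (fun i _ => (hu i).le) (Finset.mem_univ i)
  have h := Finset.single_le_sum (f := fun i => (M - u i) * (1 - a i))
    (fun i _ => mul_nonneg (by linarith [hle i])
      (by linarith [(mem_Icc_of_mem_zero_one (ha i)).2])) (Finset.mem_univ k)
  simp only [hk] at h
  linarith [hle k]

end

lemma mem_convexHull_Icc_prod {E F : Type*} [AddCommGroup E] [Module ℝ E] [AddCommGroup F]
    [Module ℝ F] {A : Set E} {B : Set F} {W : ℝ} {x : ℝ × E × F} (hx : |x.1| ≤ W)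
    (hA : x.2.1 ∈ convexHull ℝ A) (hB : x.2.2 ∈ convexHull ℝ B) :
    x ∈ convexHull ℝ (Set.Icc (-W) W ×ˢ A ×ˢ B) := by
  rw [convexHull_prod, convexHull_prod, (convex_Icc (-W) W).convexHull_eq]
  exact ⟨abs_le.mp hx, hA, hB⟩

/-- **Convex hull of R equals the convex hull of the union of the three
disjunct polytopes P1 ∪ P2 ∪ P3.** -/
theorem convexHull_eq_convexHull_union
    (p q : ℕ) (hp : 1 ≤ p) (hq : 1 ≤ q)
    (u : Fin p → ℝ) (v : Fin q → ℝ)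
    (hu : ∀ i, 0 < u i) (hv : ∀ j, 0 < v j)
    (W₁ W₂ M : ℝ) (hW₁ : W₁ = ∑ i, u i) (hW₂ : W₂ = ∑ j, v j)
    (hWW : W₁ < W₂) (hWM : W₂ < M)
    (P₁ P₂ P₃ : Set (ℝ × (Fin p → ℝ) × (Fin q → ℝ)))
    (hP₁ : P₁ = {x : ℝ × (Fin p → ℝ) × (Fin q → ℝ) |
      |x.1| ≤ W₁ ∧ (∀ i, x.2.1 i = 1) ∧
      (∀ i, 0 ≤ x.2.1 i ∧ x.2.1 i ≤ 1) ∧ (∀ j, 0 ≤ x.2.2 j ∧ x.2.2 j ≤ 1)})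
    (hP₂ : P₂ = {x : ℝ × (Fin p → ℝ) × (Fin q → ℝ) |
      |x.1| ≤ W₂ ∧ (∀ j, x.2.2 j = 1) ∧ (∑ i, x.2.1 i) ≤ (p : ℝ) - 1 ∧
      (∀ i, 0 ≤ x.2.1 i ∧ x.2.1 i ≤ 1) ∧ (∀ j, 0 ≤ x.2.2 j ∧ x.2.2 j ≤ 1)})
    (hP₃ : P₃ = {x : ℝ × (Fin p → ℝ) × (Fin q → ℝ) |
      |x.1| ≤ M ∧ (∑ i, x.2.1 i) ≤ (p : ℝ) - 1 ∧ (∑ j, x.2.2 j) ≤ (q : ℝ) - 1 ∧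
      (∀ i, 0 ≤ x.2.1 i ∧ x.2.1 i ≤ 1) ∧ (∀ j, 0 ≤ x.2.2 j ∧ x.2.2 j ≤ 1)})
    (R : Set (ℝ × (Fin p → ℝ) × (Fin q → ℝ)))
    (hR : R = {x : ℝ × (Fin p → ℝ) × (Fin q → ℝ) |
      (∀ i, x.2.1 i ∈ ({0, 1} : Set ℝ)) ∧ (∀ j, x.2.2 j ∈ ({0, 1} : Set ℝ)) ∧
      |x.1| ≤ W₁ + ∑ i, (M - u i) * (1 - x.2.1 i) ∧
      |x.1| ≤ W₂ + ∑ j, (M - v j) * (1 - x.2.2 j) ∧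
      |x.1| ≤ M}) :
    convexHull ℝ R = convexHull ℝ (P₁ ∪ P₂ ∪ P₃) := by
  have hone : ∀ {n : ℕ} {a : Fin n → ℝ}, (∀ i, a i = 1) → a ∈ convexHull ℝ {(1 : Fin n → ℝ)} :=
    fun h => subset_convexHull ℝ _ (funext h)
  apply Set.Subset.antisymm
  · apply convexHull_mono
    subst hP₁ hP₂ hP₃ hR
    rintro ⟨t, a, b⟩ ⟨ha, hb, h₁, h₂, hM⟩
    dsimp only at ha hb h₁ h₂ hM
    have ha' := fun i => mem_Icc_of_mem_zero_one (ha i)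
    have hb' := fun j => mem_Icc_of_mem_zero_one (hb j)
    rcases eq_one_or_mem_binaryVectorsWithZero ha with rfl | ha₀
    · exact Or.inl (Or.inl ⟨by simpa using h₁, fun _ => rfl, ha', hb'⟩)
    have hsa : ∑ i, a i ≤ (p : ℝ) - 1 := by simpa using sum_le_card_sub_one ha₀
    rcases eq_one_or_mem_binaryVectorsWithZero hb with rfl | hb₀
    · exact Or.inl (Or.inr ⟨by simpa using h₂, fun _ => rfl, hsa, ha', hb'⟩)
    · exact Or.inr ⟨hM, hsa, by simpa using sum_le_card_sub_one hb₀, ha', hb'⟩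
  · refine convexHull_min ?_ (convex_convexHull ℝ R)
    have hua : ∀ a ∈ binaryVectorsWithZero (Fin p),
        M ≤ W₁ + ∑ i, (M - u i) * (1 - a i) := fun a ha => by
      rw [hW₁]
      exact le_bigM_bound hu (by linarith) ha
    have hvb : ∀ b ∈ binaryVectorsWithZero (Fin q),
        M ≤ W₂ + ∑ j, (M - v j) * (1 - b j) := fun b hb => by
      rw [hW₂]
      exact le_bigM_bound hv (by linarith) hb
    have hvb' : ∀ b ∈ binaryVectors (Fin q),
        W₂ ≤ W₂ + ∑ j, (M - v j) * (1 - b j) := fun b hb => by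
      rcases eq_one_or_mem_binaryVectorsWithZero hb with rfl | hb₀
      · simp
      · exact hWM.le.trans (hvb b hb₀)
    rintro x ((hx | hx) | hx)
    · rw [hP₁] at hx
      obtain ⟨ht, ha₁, -, hb⟩ := hx
      refine convexHull_mono ?_
        (mem_convexHull_Icc_prod ht (hone ha₁) (mem_convexHull_binaryVectors hb))
      rintro ⟨t, a, b⟩ ⟨ht, rfl, hb⟩
      have ht : |t| ≤ W₁ := abs_le.mpr ht
      rw [hR]
      exact ⟨fun _ => Or.inr rfl, hb, by simpa using ht,
        (ht.trans hWW.le).trans (hvb' b hb), by dsimp only; linarith⟩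
    · rw [hP₂] at hx
      obtain ⟨ht, hb₁, hsa, ha, -⟩ := hx
      refine convexHull_mono ?_ (mem_convexHull_Icc_prod ht
        (mem_convexHull_binaryVectorsWithZero ha (by simpa using hsa)) (hone hb₁))
      rintro ⟨t, a, b⟩ ⟨ht, ha, rfl⟩
      have ht : |t| ≤ W₂ := abs_le.mpr ht
      rw [hR]
      exact ⟨ha.1, fun _ => Or.inr rfl, (ht.trans hWM.le).trans (hua a ha), by simpa using ht,
        ht.trans hWM.le⟩
    · rw [hP₃] at hx
      obtain ⟨ht, hsa, hsb, ha, hb⟩ := hx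
      refine convexHull_mono ?_ (mem_convexHull_Icc_prod ht
        (mem_convexHull_binaryVectorsWithZero ha (by simpa using hsa))
        (mem_convexHull_binaryVectorsWithZero hb (by simpa using hsb)))
      rintro ⟨t, a, b⟩ ⟨ht, ha, hb⟩
      have ht : |t| ≤ M := abs_le.mpr ht
      rw [hR]
      exact ⟨ha.1, hb.1, ht.trans (hua a ha), ht.trans (hvb b hb), ht⟩
end

section
/- Each disjunct polytope is integral with respect to the binary variables: for each k ∈ {1,2,3}, letting B := { (t, a, b) | ∀ i, a i ∈ ({0,1} : Set ℝ) ∧ ∀ j, b j ∈ ({0,1} : Set ℝ) }, one has P_k = convexHull ℝ (P_k ∩ B). -/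
/-- The unit cube is the convex hull of the binary vectors. -/
theorem cube_eq_convexHull {ι : Type*} [Fintype ι] :
    {a : ι → ℝ | ∀ i, 0 ≤ a i ∧ a i ≤ 1} =
      convexHull ℝ {a : ι → ℝ | ∀ i, a i ∈ ({0, 1} : Set ℝ)} := by
  have h : {a : ι → ℝ | ∀ i, a i ∈ ({0, 1} : Set ℝ)} =
      Set.univ.pi fun _ => ({0, 1} : Set ℝ) := by
    ext; simp
  rw [h, convexHull_pi]
  ext a
  simp [convexHull_pair, segment_eq_Icc, Pi.le_def, forall_and]

/-- The points of the unit cube with coordinate sum at most `card ι - 1` are the convex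
combinations of the binary vectors other than the all-ones vector. -/
theorem truncatedCube_eq_convexHull {ι : Type*} [Fintype ι] :
    {a : ι → ℝ | ∑ i, a i ≤ (Fintype.card ι : ℝ) - 1 ∧ ∀ i, 0 ≤ a i ∧ a i ≤ 1} =
      convexHull ℝ {a : ι → ℝ | ∑ i, a i ≤ (Fintype.card ι : ℝ) - 1 ∧
        ∀ i, a i ∈ ({0, 1} : Set ℝ)} := by
  classical
  apply Set.Subset.antisymm
  · rintro a ⟨hs, ha⟩
    set S : ℝ := ∑ i, (1 - a i) with hS
    have hS1 : 1 ≤ S := by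
      rw [hS, Finset.sum_sub_distrib]; simp; linarith
    have hS0 : 0 < S := by linarith
    let l : ι → ℝ := fun i => (1 - a i) / S
    have hl0 : ∀ i, 0 ≤ l i := fun i => div_nonneg (by linarith [(ha i).2]) hS0.le
    have hl1 : ∑ i, l i = 1 := by
      simp only [l]; rw [← Finset.sum_div, ← hS, div_self hS0.ne']
    have hle : ∀ i, l i ≤ 1 - a i := fun i => div_le_self (by linarith [(ha i).2]) hS1
    let r : ι → ℝ := fun j => a j / (1 - l j)
    have hr : ∀ j, r j * (1 - l j) = a j := by
      intro j
      rcases eq_or_ne (1 - l j) 0 with h | h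
      · rw [h, mul_zero]
        linarith [hle j, (ha j).1]
      · exact div_mul_cancel₀ _ h
    have hr01 : ∀ j, 0 ≤ r j ∧ r j ≤ 1 := fun j =>
      ⟨div_nonneg (ha j).1 (by linarith [hle j, (ha j).1]),
        div_le_one_of_le₀ (by linarith [hle j]) (by linarith [hle j, (ha j).1])⟩
    have hsum : a = ∑ i, l i • Function.update r i 0 := by
      ext j
      have hj : ∀ i, l i * Function.update r i 0 j = r j * l i - if i = j then r j * l i else 0 := by
        intro i
        by_cases h : i = j
        · subst h; simp
        · rw [Function.update_of_ne (Ne.symm h)]; simp [h, mul_comm]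
      simp only [Finset.sum_apply, Pi.smul_apply, smul_eq_mul, hj, Finset.sum_sub_distrib,
        ← Finset.mul_sum, hl1, Finset.sum_ite_eq', Finset.mem_univ, if_true]
      linarith [hr j]
    rw [hsum]
    refine (convex_convexHull ℝ _).sum_mem (fun i _ => hl0 i) hl1 fun i _ => ?_
    have hmem : Function.update r i 0 ∈
        convexHull ℝ (Set.univ.pi fun j => if j = i then ({0} : Set ℝ) else {0, 1}) := by
      rw [convexHull_pi]
      intro j _
      by_cases h : j = i
      · subst h; simp
      · simpa [h, convexHull_pair, segment_eq_Icc] using hr01 j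
    refine convexHull_mono (fun x hx => ?_) hmem
    have hx' : ∀ j, x j ∈ if j = i then ({0} : Set ℝ) else {0, 1} := fun j => hx j trivial
    have hxi : x i = 0 := by simpa using hx' i
    have hx01 : ∀ j, x j ∈ ({0, 1} : Set ℝ) := by
      intro j
      by_cases h : j = i
      · subst h; simp [hxi]
      · simpa [h] using hx' j
    refine ⟨?_, hx01⟩
    have hle : ∑ j, x j ≤ ∑ j, (1 - if j = i then (1 : ℝ) else 0) := by
      refine Finset.sum_le_sum fun j _ => ?_
      by_cases h : j = i
      · subst h; simp [hxi]
      · rcases hx01 j with h' | h' <;> simp_all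
    simpa [Finset.sum_sub_distrib] using hle
  · refine convexHull_min ?_ ?_
    · rintro a ⟨hs, ha⟩
      refine ⟨hs, fun i => ?_⟩
      rcases ha i with h | h <;> simp_all
    · rintro a ⟨hs, ha⟩ b ⟨ht, hb⟩ x y hx hy hxy
      refine ⟨?_, fun i => ?_⟩
      · simp only [Pi.add_apply, Pi.smul_apply, smul_eq_mul, Finset.sum_add_distrib,
          ← Finset.mul_sum]
        exact (convex_Iic ((Fintype.card ι : ℝ) - 1)) (Set.mem_Iic.2 hs) (Set.mem_Iic.2 ht) hx hy hxy
      · exact (convex_Icc (0 : ℝ) 1) (ha i) (hb i) hx hy hxy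

/-- The product of a symmetric interval and two convex hulls is the convex hull of the product of
the interval and the generating sets. -/
theorem Icc_prod_convexHull_prod {E F : Type*} [AddCommGroup E] [Module ℝ E] [AddCommGroup F]
    [Module ℝ F] (W : ℝ) (A : Set E) (B : Set F) :
    Set.Icc (-W) W ×ˢ convexHull ℝ A ×ˢ convexHull ℝ B =
      convexHull ℝ (Set.Icc (-W) W ×ˢ A ×ˢ B) := by
  rw [convexHull_prod, convexHull_prod, (convex_Icc _ _).convexHull_eq]

theorem ones_eq_convexHull {ι : Type*} :
    {a : ι → ℝ | ∀ i, a i = 1} = convexHull ℝ {a : ι → ℝ | ∀ i, a i = 1} := by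
  have h : {a : ι → ℝ | ∀ i, a i = 1} = {1} := by
    ext a; simp [funext_iff]
  rw [h, convexHull_singleton]

/-- **Integrality of the disjunct polytopes.**
Each Pk equals the convex hull of its points with binary a, b. -/
theorem disjuncts_integral
    (p q : ℕ) (hp : 1 ≤ p) (hq : 1 ≤ q)
    (u : Fin p → ℝ) (v : Fin q → ℝ)
    (hu : ∀ i, 0 < u i) (hv : ∀ j, 0 < v j)
    (W₁ W₂ M : ℝ) (hW₁ : W₁ = ∑ i, u i) (hW₂ : W₂ = ∑ j, v j)
    (hWW : W₁ < W₂) (hWM : W₂ < M)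
    (P₁ P₂ P₃ : Set (ℝ × (Fin p → ℝ) × (Fin q → ℝ)))
    (hP₁ : P₁ = {x : ℝ × (Fin p → ℝ) × (Fin q → ℝ) |
      |x.1| ≤ W₁ ∧ (∀ i, x.2.1 i = 1) ∧
      (∀ i, 0 ≤ x.2.1 i ∧ x.2.1 i ≤ 1) ∧ (∀ j, 0 ≤ x.2.2 j ∧ x.2.2 j ≤ 1)})
    (hP₂ : P₂ = {x : ℝ × (Fin p → ℝ) × (Fin q → ℝ) |
      |x.1| ≤ W₂ ∧ (∀ j, x.2.2 j = 1) ∧ (∑ i, x.2.1 i) ≤ (p : ℝ) - 1 ∧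
      (∀ i, 0 ≤ x.2.1 i ∧ x.2.1 i ≤ 1) ∧ (∀ j, 0 ≤ x.2.2 j ∧ x.2.2 j ≤ 1)})
    (hP₃ : P₃ = {x : ℝ × (Fin p → ℝ) × (Fin q → ℝ) |
      |x.1| ≤ M ∧ (∑ i, x.2.1 i) ≤ (p : ℝ) - 1 ∧ (∑ j, x.2.2 j) ≤ (q : ℝ) - 1 ∧
      (∀ i, 0 ≤ x.2.1 i ∧ x.2.1 i ≤ 1) ∧ (∀ j, 0 ≤ x.2.2 j ∧ x.2.2 j ≤ 1)})
    (B : Set (ℝ × (Fin p → ℝ) × (Fin q → ℝ)))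
    (hB : B = {x : ℝ × (Fin p → ℝ) × (Fin q → ℝ) |
      (∀ i, x.2.1 i ∈ ({0, 1} : Set ℝ)) ∧ (∀ j, x.2.2 j ∈ ({0, 1} : Set ℝ))}) :
    P₁ = convexHull ℝ (P₁ ∩ B) ∧ P₂ = convexHull ℝ (P₂ ∩ B) ∧
    P₃ = convexHull ℝ (P₃ ∩ B) := by
  subst hP₁ hP₂ hP₃ hB
  have hcube := cube_eq_convexHull (ι := Fin q)
  have hp' := truncatedCube_eq_convexHull (ι := Fin p)
  have hq' := truncatedCube_eq_convexHull (ι := Fin q)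
  rw [Fintype.card_fin] at hp' hq'
  have h01 : ∀ x : ℝ, x = 1 → 0 ≤ x ∧ x ≤ 1 := by rintro x rfl; simp
  have hbin : ∀ x : ℝ, x ∈ ({0, 1} : Set ℝ) → 0 ≤ x ∧ x ≤ 1 := by
    rintro x (rfl | rfl) <;> simp
  have hone : ∀ x : ℝ, x = 1 → x ∈ ({0, 1} : Set ℝ) := fun x h => Or.inr h
  refine ⟨?_, ?_, ?_⟩
  · convert Icc_prod_convexHull_prod W₁ {a : Fin p → ℝ | ∀ i, a i = 1}
      {b : Fin q → ℝ | ∀ j, b j ∈ ({0, 1} : Set ℝ)} using 1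
    · rw [← hcube, ← ones_eq_convexHull]
      ext ⟨t, a, b⟩
      simp only [Set.mem_ofPred_eq, Set.mem_prod, Set.mem_Icc, abs_le]
      exact ⟨fun h => ⟨h.1, h.2.1, h.2.2.2⟩, fun h => ⟨h.1, h.2.1, fun i => h01 _ (h.2.1 i), h.2.2⟩⟩
    · congr 1
      ext ⟨t, a, b⟩
      simp only [Set.mem_inter_iff, Set.mem_ofPred_eq, Set.mem_prod, Set.mem_Icc, abs_le]
      exact ⟨fun h => ⟨h.1.1, h.1.2.1, h.2.2⟩, fun h => ⟨⟨h.1, h.2.1, fun i => h01 _ (h.2.1 i),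
        fun j => hbin _ (h.2.2 j)⟩, fun i => hone _ (h.2.1 i), h.2.2⟩⟩
  · convert Icc_prod_convexHull_prod W₂ {a : Fin p → ℝ | ∑ i, a i ≤ (p : ℝ) - 1 ∧
      ∀ i, a i ∈ ({0, 1} : Set ℝ)} {b : Fin q → ℝ | ∀ j, b j = 1} using 1
    · rw [← hp', ← ones_eq_convexHull]
      ext ⟨t, a, b⟩
      simp only [Set.mem_ofPred_eq, Set.mem_prod, Set.mem_Icc, abs_le]
      exact ⟨fun h => ⟨h.1, ⟨h.2.2.1, h.2.2.2.1⟩, h.2.1⟩,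
        fun h => ⟨h.1, h.2.2, h.2.1.1, h.2.1.2, fun j => h01 _ (h.2.2 j)⟩⟩
    · congr 1
      ext ⟨t, a, b⟩
      simp only [Set.mem_inter_iff, Set.mem_ofPred_eq, Set.mem_prod, Set.mem_Icc, abs_le]
      exact ⟨fun h => ⟨h.1.1, ⟨h.1.2.2.1, h.2.1⟩, h.1.2.1⟩, fun h => ⟨⟨h.1, h.2.2, h.2.1.1,
        fun i => hbin _ (h.2.1.2 i), fun j => h01 _ (h.2.2 j)⟩, h.2.1.2,
        fun j => hone _ (h.2.2 j)⟩⟩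
  · convert Icc_prod_convexHull_prod M {a : Fin p → ℝ | ∑ i, a i ≤ (p : ℝ) - 1 ∧
      ∀ i, a i ∈ ({0, 1} : Set ℝ)} {b : Fin q → ℝ | ∑ j, b j ≤ (q : ℝ) - 1 ∧
      ∀ j, b j ∈ ({0, 1} : Set ℝ)} using 1
    · rw [← hp', ← hq']
      ext ⟨t, a, b⟩
      simp only [Set.mem_ofPred_eq, Set.mem_prod, Set.mem_Icc, abs_le]
      tauto
    · congr 1
      ext ⟨t, a, b⟩
      simp only [Set.mem_inter_iff, Set.mem_ofPred_eq, Set.mem_prod, Set.mem_Icc, abs_le]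
      exact ⟨fun h => ⟨h.1.1, ⟨h.1.2.1, h.2.1⟩, h.1.2.2.1, h.2.2⟩, fun h => ⟨⟨h.1, h.2.1.1, h.2.2.1,
        fun i => hbin _ (h.2.1.2 i), fun j => hbin _ (h.2.2.2 j)⟩, h.2.1.2, h.2.2.2⟩⟩
end

section
/- The extended formulation is locally ideal: for every extreme point (t, a, b, z₁, z₂, ζ) of the extended polytope P (in the sense of Set.extremePoints ℝ P), all coordinates a i for i : Fin p, b j for j : Fin q, and z₁, z₂, ζ lie in ({0,1} : Set ℝ). -/
/-- The linear relaxation of `z = ⋀ i, a i` for numbers in the unit interval. -/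
def IsConjRelaxation {n : ℕ} (a : Fin n → ℝ) (z : ℝ) : Prop :=
  (∀ i, 0 ≤ a i ∧ a i ≤ 1 ∧ z ≤ a i) ∧ (∑ i, a i) - (n : ℝ) + 1 ≤ z

/-- The linear relaxation of `ζ = ¬ z₁ ∧ z₂` for numbers in the unit interval. -/
def IsGuardRelaxation (z₁ z₂ ζ : ℝ) : Prop :=
  0 ≤ ζ ∧ ζ ≤ z₂ ∧ ζ ≤ 1 - z₁ ∧ z₂ - z₁ ≤ ζ ∧ 0 ≤ z₁ ∧ z₁ ≤ 1 ∧ 0 ≤ z₂ ∧ z₂ ≤ 1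

theorem eq_zero_of_add_mem_of_sub_mem {E : Type*} [AddCommGroup E] [Module ℝ E] {P : Set E}
    {x d : E} (hx : x ∈ Set.extremePoints ℝ P) (hadd : x + d ∈ P) (hsub : x - d ∈ P) :
    d = 0 := by
  have h : x ∈ openSegment ℝ (x + d) (x - d) :=
    ⟨1 / 2, 1 / 2, by norm_num, by norm_num, by norm_num, by module⟩
  simpa using hx.2 hadd hsub h

theorem eq_mul_of_abs_le {t B : ℝ} (h : |t| ≤ B) : ∃ τ : ℝ, |τ| ≤ 1 ∧ t = τ * B := by
  have hB : 0 ≤ B := (abs_nonneg t).trans h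
  rcases hB.eq_or_lt with rfl | hB
  · exact ⟨0, by simp, by simpa using h⟩
  · exact ⟨t / B, by rwa [abs_div, abs_of_pos hB, div_le_one hB], by field_simp⟩

namespace IsConjRelaxation

variable {n : ℕ} {a : Fin n → ℝ} {z : ℝ}

/-- If no nonzero direction keeps `a` feasible at fixed `z`, every entry is `z` or `1`. -/
theorem eq_or_eq_one (h : IsConjRelaxation a z) (hz0 : 0 ≤ z)
    (hrigid : ∀ d : Fin n → ℝ, IsConjRelaxation (a + d) z → IsConjRelaxation (a - d) z → d = 0)
    (i : Fin n) : a i = z ∨ a i = 1 := by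
  by_contra! hi
  obtain ⟨hbox, hsum⟩ := h
  have hzi : z < a i := lt_of_le_of_ne (hbox i).2.2 hi.1.symm
  have hi1 : a i < 1 := lt_of_le_of_ne (hbox i).2.1 hi.2
  rcases hsum.eq_or_lt with heq | hlt
  · obtain ⟨k, hki, hk⟩ : ∃ k ≠ i, a k < 1 := by
      by_contra! hk
      have hone : ∀ k ∈ Finset.univ.erase i, a k = 1 := fun k hk' =>
        le_antisymm (hbox k).2.1 (hk k (Finset.ne_of_mem_erase hk'))
      have hs := Finset.add_sum_erase Finset.univ a (Finset.mem_univ i)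
      have hc := Finset.add_sum_erase Finset.univ (fun _ : Fin n => (1 : ℝ)) (Finset.mem_univ i)
      rw [Finset.sum_congr rfl hone] at hs
      simp only [Finset.sum_const, Finset.card_univ, Fintype.card_fin, nsmul_eq_mul,
        mul_one] at hs hc
      linarith
    have hpair : z + 1 ≤ a i + a k := by
      have hnn : ∀ j ∈ Finset.univ, 0 ≤ 1 - a j := fun j _ => sub_nonneg.2 (hbox j).2.1
      have hle := Finset.sum_le_sum_of_subset_of_nonneg (Finset.subset_univ {i, k})
        fun j hj _ => hnn j hj
      rw [Finset.sum_pair hki.symm] at hle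
      simp only [Finset.sum_sub_distrib, Finset.sum_const, Finset.card_univ, Fintype.card_fin,
        nsmul_eq_mul, mul_one] at hle
      linarith
    set ε := min (1 - a i) (1 - a k)
    have hε0 : 0 < ε := lt_min (by linarith) (by linarith)
    have hεi : ε ≤ 1 - a i := min_le_left _ _
    have hεk : ε ≤ 1 - a k := min_le_right _ _
    have hz := hrigid (Pi.single i ε - Pi.single k ε) ⟨fun j => ?_, ?_⟩ ⟨fun j => ?_, ?_⟩
    · have := congrFun hz i
      simp [hki.symm] at this
      exact hε0.ne' this
    · obtain ⟨h0, h1, h2⟩ := hbox j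
      rcases eq_or_ne j i with rfl | hji
      · simp [hki.symm]
        exact ⟨by linarith, by linarith, by linarith⟩
      · rcases eq_or_ne j k with rfl | hjk
        · simp [hki]
          exact ⟨by linarith, by linarith, by linarith⟩
        · simp [hji, hjk, h0, h1, h2]
    · simp [Finset.sum_add_distrib, Finset.sum_sub_distrib, hsum]
    · obtain ⟨h0, h1, h2⟩ := hbox j
      rcases eq_or_ne j i with rfl | hji
      · simp [hki.symm]
        exact ⟨by linarith, by linarith, by linarith⟩
      · rcases eq_or_ne j k with rfl | hjk
        · simp [hki]
          exact ⟨by linarith, by linarith, by linarith⟩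
        · simp [hji, hjk, h0, h1, h2]
    · simp [Finset.sum_sub_distrib, hsum]
  · set ε := min (min (a i - z) (1 - a i)) (z - ((∑ i, a i) - n + 1))
    have hε0 : 0 < ε := lt_min (lt_min (by linarith) (by linarith)) (by linarith)
    have hεz : ε ≤ a i - z := (min_le_left _ _).trans (min_le_left _ _)
    have hεi : ε ≤ 1 - a i := (min_le_left _ _).trans (min_le_right _ _)
    have hεs : ε ≤ z - ((∑ i, a i) - n + 1) := min_le_right _ _
    have hz := hrigid (Pi.single i ε) ⟨fun j => ?_, ?_⟩ ⟨fun j => ?_, ?_⟩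
    · have := congrFun hz i
      simp at this
      exact hε0.ne' this
    · obtain ⟨h0, h1, h2⟩ := hbox j
      rcases eq_or_ne j i with rfl | hji
      · simp
        exact ⟨by linarith, by linarith, by linarith⟩
      · simp [hji, h0, h1, h2]
    · simp [Finset.sum_add_distrib]
      linarith
    · obtain ⟨h0, h1, h2⟩ := hbox j
      rcases eq_or_ne j i with rfl | hji
      · simp
        exact ⟨by linarith, by linarith, by linarith⟩
      · simp [hji, h0, h1, h2]
    · simp [Finset.sum_sub_distrib]
      linarith

theorem exists_eq (h : IsConjRelaxation a z) (hn : 1 ≤ n) (hz1 : z ≤ 1)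
    (hvert : ∀ i, a i = z ∨ a i = 1) : ∃ k, a k = z := by
  by_contra! hk
  have hone : ∀ i, a i = 1 := fun i => (hvert i).resolve_left (hk i)
  have hs := h.2
  simp only [hone, Finset.sum_const, Finset.card_univ, Fintype.card_fin, nsmul_eq_mul,
    mul_one] at hs
  exact hk ⟨0, hn⟩ ((hone _).trans (by linarith))

/-- Moving all the entries equal to `z` along with `z` preserves feasibility. -/
theorem add_ite (hvert : ∀ i, a i = z ∨ a i = 1) (hex : ∃ k, a k = z) {d : ℝ}
    (h0 : 0 ≤ z + d) (h1 : z + d ≤ 1) :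
    IsConjRelaxation (fun i => a i + if a i = z then d else 0) (z + d) := by
  have hbox : ∀ i, 0 ≤ (a i + if a i = z then d else 0) ∧
      (a i + if a i = z then d else 0) ≤ 1 ∧ z + d ≤ a i + if a i = z then d else 0 := by
    intro i
    split_ifs with hi
    · rw [hi]
      exact ⟨h0, h1, le_rfl⟩
    · rw [(hvert i).resolve_left hi]
      simpa using h1
  refine ⟨hbox, ?_⟩
  obtain ⟨k, hk⟩ := hex
  have hle := Finset.single_le_sum (f := fun i => 1 - (a i + if a i = z then d else 0))
    (fun i _ => sub_nonneg.2 (hbox i).2.1) (Finset.mem_univ k)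
  rw [Finset.sum_sub_distrib] at hle
  simp only [hk, if_true, Finset.sum_const, Finset.card_univ, Fintype.card_fin, nsmul_eq_mul,
    mul_one] at hle
  linarith

end IsConjRelaxation

namespace IsGuardRelaxation

/-- The feasible points of the guard relaxation admitting no nonzero feasible direction are
integral. -/
theorem integral {z₁ z₂ ζ : ℝ} (h : IsGuardRelaxation z₁ z₂ ζ)
    (hrigid : ∀ d₁ d₂ δ : ℝ, IsGuardRelaxation (z₁ + d₁) (z₂ + d₂) (ζ + δ) →
      IsGuardRelaxation (z₁ - d₁) (z₂ - d₂) (ζ - δ) → d₁ = 0 ∧ d₂ = 0 ∧ δ = 0) :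
    (z₁ = 0 ∨ z₁ = 1) ∧ (z₂ = 0 ∨ z₂ = 1) ∧ (ζ = 0 ∨ ζ = 1) := by
  obtain ⟨h1, h2, h3, h4, h5, h6, h7, h8⟩ := h
  have hsum : z₁ + ζ = 0 ∨ z₁ + ζ = 1 := by
    by_contra! hs
    have hs0 : 0 < z₁ + ζ := lt_of_le_of_ne (by linarith) hs.1.symm
    have hs1 : z₁ + ζ < 1 := lt_of_le_of_ne (by linarith) hs.2
    set s := z₁ + ζ with hs_def
    obtain ⟨e1, -, e3⟩ := hrigid ((1 - s) * z₁) ((1 - s) * z₂) ((1 - s) * ζ)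
      ⟨by nlinarith, by nlinarith, by nlinarith, by nlinarith, by nlinarith, by nlinarith,
        by nlinarith, by nlinarith⟩
      ⟨by nlinarith, by nlinarith, by nlinarith, by nlinarith, by nlinarith, by nlinarith,
        by nlinarith, by nlinarith⟩
    have : (1 - s) * s = 0 := by linear_combination e1 + e3
    nlinarith
  rcases hsum with hs | hs
  · exact ⟨.inl (by linarith), .inl (by linarith), .inl (by linarith)⟩
  have hz₁ : z₁ = 0 ∨ z₁ = 1 := by
    by_contra! hz
    have hz0 : 0 < z₁ := lt_of_le_of_ne h5 hz.1.symm
    have hz1 : z₁ < 1 := lt_of_le_of_ne h6 hz.2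
    rcases eq_or_lt_of_le (show 1 ≤ z₁ + z₂ by linarith) with he | hl
    · set ε := min z₁ (1 - z₁)
      have hε : 0 < ε := lt_min hz0 (by linarith)
      have hε1 : ε ≤ z₁ := min_le_left _ _
      have hε2 : ε ≤ 1 - z₁ := min_le_right _ _
      have e := (hrigid ε (-ε) (-ε)
        ⟨by linarith, by linarith, by linarith, by linarith, by linarith, by linarith,
          by linarith, by linarith⟩
        ⟨by linarith, by linarith, by linarith, by linarith, by linarith, by linarith,
          by linarith, by linarith⟩).1
      exact hε.ne' e
    · set ε := min (min z₁ (1 - z₁)) (z₁ + z₂ - 1)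
      have hε : 0 < ε := lt_min (lt_min hz0 (by linarith)) (by linarith)
      have hε1 : ε ≤ z₁ := (min_le_left _ _).trans (min_le_left _ _)
      have hε2 : ε ≤ 1 - z₁ := (min_le_left _ _).trans (min_le_right _ _)
      have hε3 : ε ≤ z₁ + z₂ - 1 := min_le_right _ _
      have e := (hrigid ε 0 (-ε)
        ⟨by linarith, by linarith, by linarith, by linarith, by linarith, by linarith,
          by linarith, by linarith⟩
        ⟨by linarith, by linarith, by linarith, by linarith, by linarith, by linarith,
          by linarith, by linarith⟩).1
      exact hε.ne' e
  rcases hz₁ with hz | hz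
  · exact ⟨.inl hz, .inr (by linarith), .inr (by linarith)⟩
  refine ⟨.inr hz, ?_, .inl (by linarith)⟩
  by_contra! hz'
  have hz0 : 0 < z₂ := lt_of_le_of_ne h7 hz'.1.symm
  have hz1 : z₂ < 1 := lt_of_le_of_ne h8 hz'.2
  set ε := min z₂ (1 - z₂)
  have hε : 0 < ε := lt_min hz0 (by linarith)
  have hε1 : ε ≤ z₂ := min_le_left _ _
  have hε2 : ε ≤ 1 - z₂ := min_le_right _ _
  have e := (hrigid 0 ε 0
    ⟨by linarith, by linarith, by linarith, by linarith, by linarith, by linarith,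
      by linarith, by linarith⟩
    ⟨by linarith, by linarith, by linarith, by linarith, by linarith, by linarith,
      by linarith, by linarith⟩).2.1
  exact hε.ne' e

end IsGuardRelaxation


/-- **Local ideality of the extended formulation.**
Every extreme point of the extended polytope P has binary values in the
coordinates a, b, z1, z2, zeta. -/
theorem extended_formulation_locally_ideal
    (p q : ℕ) (hp : 1 ≤ p) (hq : 1 ≤ q)
    (u : Fin p → ℝ) (v : Fin q → ℝ)
    (hu : ∀ i, 0 < u i) (hv : ∀ j, 0 < v j)
    (W₁ W₂ M : ℝ) (hW₁ : W₁ = ∑ i, u i) (hW₂ : W₂ = ∑ j, v j)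
    (hWW : W₁ < W₂) (hWM : W₂ < M)
    (P : Set (ℝ × (Fin p → ℝ) × (Fin q → ℝ) × ℝ × ℝ × ℝ))
    (hP : P = {x : ℝ × (Fin p → ℝ) × (Fin q → ℝ) × ℝ × ℝ × ℝ |
      (∀ i, 0 ≤ x.2.1 i ∧ x.2.1 i ≤ 1 ∧ x.2.2.2.1 ≤ x.2.1 i) ∧
      (∑ i, x.2.1 i) - (p : ℝ) + 1 ≤ x.2.2.2.1 ∧
      (∀ j, 0 ≤ x.2.2.1 j ∧ x.2.2.1 j ≤ 1 ∧ x.2.2.2.2.1 ≤ x.2.2.1 j) ∧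
      (∑ j, x.2.2.1 j) - (q : ℝ) + 1 ≤ x.2.2.2.2.1 ∧
      0 ≤ x.2.2.2.2.2 ∧ x.2.2.2.2.2 ≤ x.2.2.2.2.1 ∧
      x.2.2.2.2.2 ≤ 1 - x.2.2.2.1 ∧ x.2.2.2.2.1 - x.2.2.2.1 ≤ x.2.2.2.2.2 ∧
      0 ≤ x.2.2.2.1 ∧ x.2.2.2.1 ≤ 1 ∧ 0 ≤ x.2.2.2.2.1 ∧ x.2.2.2.2.1 ≤ 1 ∧
      |x.1| ≤ W₁ * x.2.2.2.1 + W₂ * x.2.2.2.2.2 + M * (1 - x.2.2.2.1 - x.2.2.2.2.2)}) :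
    ∀ x ∈ Set.extremePoints ℝ P,
      (∀ i, x.2.1 i ∈ ({0, 1} : Set ℝ)) ∧ (∀ j, x.2.2.1 j ∈ ({0, 1} : Set ℝ)) ∧
      x.2.2.2.1 ∈ ({0, 1} : Set ℝ) ∧ x.2.2.2.2.1 ∈ ({0, 1} : Set ℝ) ∧
      x.2.2.2.2.2 ∈ ({0, 1} : Set ℝ) := by
  have hmem : ∀ t a b z₁ z₂ ζ, (t, a, b, z₁, z₂, ζ) ∈ P ↔ IsConjRelaxation a z₁ ∧
      IsConjRelaxation b z₂ ∧ IsGuardRelaxation z₁ z₂ ζ ∧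
      |t| ≤ W₁ * z₁ + W₂ * ζ + M * (1 - z₁ - ζ) := by
    intro t a b z₁ z₂ ζ
    simp only [hP, Set.mem_ofPred_eq, IsConjRelaxation, IsGuardRelaxation, and_assoc]
  rintro ⟨t, a, b, z₁, z₂, ζ⟩ hx
  obtain ⟨ha, hb, hg, ht⟩ := (hmem _ _ _ _ _ _).1 hx.1
  have hg' := hg
  obtain ⟨-, -, -, -, hz₁0, hz₁, hz₂0, hz₂⟩ := hg'
  have hva : ∀ i, a i = z₁ ∨ a i = 1 := ha.eq_or_eq_one hz₁0 fun d hadd hsub => by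
    have hd := eq_zero_of_add_mem_of_sub_mem (d := (0, d, 0, 0, 0, 0)) hx
      (by simpa [hmem] using ⟨hadd, hb, hg, ht⟩) (by simpa [hmem] using ⟨hsub, hb, hg, ht⟩)
    simpa using hd
  have hvb : ∀ j, b j = z₂ ∨ b j = 1 := hb.eq_or_eq_one hz₂0 fun d hadd hsub => by
    have hd := eq_zero_of_add_mem_of_sub_mem (d := (0, 0, d, 0, 0, 0)) hx
      (by simpa [hmem] using ⟨ha, hadd, hg, ht⟩) (by simpa [hmem] using ⟨ha, hsub, hg, ht⟩)
    simpa using hd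
  have hea := ha.exists_eq hp hz₁ hva
  have heb := hb.exists_eq hq hz₂ hvb
  have hW₁0 : 0 ≤ W₁ := hW₁ ▸ Finset.sum_nonneg fun i _ => (hu i).le
  obtain ⟨τ, hτ, htτ⟩ := eq_mul_of_abs_le ht
  have hmove : ∀ d₁ d₂ δ : ℝ, IsGuardRelaxation (z₁ + d₁) (z₂ + d₂) (ζ + δ) →
      ((t + τ * (W₁ * d₁ + W₂ * δ - M * (d₁ + δ)), (fun i => a i + if a i = z₁ then d₁ else 0),
        (fun j => b j + if b j = z₂ then d₂ else 0), z₁ + d₁, z₂ + d₂, ζ + δ) :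
        ℝ × (Fin p → ℝ) × (Fin q → ℝ) × ℝ × ℝ × ℝ) ∈ P := by
    intro d₁ d₂ δ h
    have h' := h
    obtain ⟨g1, -, g3, -, g5, g6, g7, g8⟩ := h'
    refine (hmem _ _ _ _ _ _).2 ⟨.add_ite hva hea g5 g6, .add_ite hvb heb g7 g8, h, ?_⟩
    have hB : 0 ≤ W₁ * (z₁ + d₁) + W₂ * (ζ + δ) + M * (1 - (z₁ + d₁) - (ζ + δ)) :=
      add_nonneg (add_nonneg (mul_nonneg hW₁0 g5) (mul_nonneg (by linarith) g1))
        (mul_nonneg (by linarith) (by linarith))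
    calc |t + τ * (W₁ * d₁ + W₂ * δ - M * (d₁ + δ))|
        = |τ| * (W₁ * (z₁ + d₁) + W₂ * (ζ + δ) + M * (1 - (z₁ + d₁) - (ζ + δ))) := by
          conv_rhs => rw [← abs_of_nonneg hB, ← abs_mul]
          rw [htτ]
          congr 1
          ring
      _ ≤ _ := mul_le_of_le_one_left hB hτ
  obtain ⟨hz₁', hz₂', hζ⟩ := hg.integral fun d₁ d₂ δ hadd hsub => by
    have hd := eq_zero_of_add_mem_of_sub_mem (d := (τ * (W₁ * d₁ + W₂ * δ - M * (d₁ + δ)),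
      (fun i => if a i = z₁ then d₁ else 0), (fun j => if b j = z₂ then d₂ else 0), d₁, d₂, δ))
      hx (hmove d₁ d₂ δ hadd) (by
        convert hmove (-d₁) (-d₂) (-δ) (by simpa only [← sub_eq_add_neg] using hsub) using 1
        ext <;> simp [-mul_eq_mul_left_iff] <;> (try split_ifs) <;> ring)
    simp only [Prod.mk_eq_zero] at hd
    exact hd.2.2.2
  refine ⟨fun i => ?_, fun j => ?_, hz₁', hz₂', hζ⟩
  · rcases hva i with h | h
    · exact h ▸ hz₁'
    · exact .inr h
  · rcases hvb j with h | h
    · exact h ▸ hz₂'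
    · exact .inr h
end

section
/- The facet certificate points lie on the C-PVI face: each of the p + q + 1 points x₀ := (W₁, fun _ => 1, fun _ => 1), x_k := (W₂, (fun _ => 1) - Pi.single k 1, fun _ => 1) for k : Fin p, and x_{p+ℓ} := (M, (fun _ => 1) - Pi.single 0 1, (fun _ => 1) - Pi.single ℓ 1) for ℓ : Fin q belongs to R and satisfies the C-PVI with equality, i.e., t = W₁ + ((p : ℝ) - ∑ i, a i) * (W₂ - W₁) + ((q : ℝ) - ∑ j, b j) * (M - W₂); moreover, the family (x₀, x₁, …, x_{p+q}) is affinely independent over ℝ. -/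
/-- **The facet certificate points lie on the C-PVI face.**
The p + q + 1 points x₀ = (W₁, 1, 1), x_k = (W₂, 1 − e_k, 1) for k : Fin p,
and x_{p+ℓ} = (M, 1 − e₀, 1 − e_ℓ) for ℓ : Fin q all belong to R, satisfy the
C-PVI with equality, and form an affinely independent family. -/
theorem facet_certificate_points
    (p q : ℕ) (hp : 1 ≤ p) (hq : 1 ≤ q)
    (u : Fin p → ℝ) (v : Fin q → ℝ)
    (hu : ∀ i, 0 < u i) (hv : ∀ j, 0 < v j)
    (W₁ W₂ M : ℝ) (hW₁ : W₁ = ∑ i, u i) (hW₂ : W₂ = ∑ j, v j)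
    (hWW : W₁ < W₂) (hWM : W₂ < M)
    (R : Set (ℝ × (Fin p → ℝ) × (Fin q → ℝ)))
    (hR : R = {x : ℝ × (Fin p → ℝ) × (Fin q → ℝ) |
      (∀ i, x.2.1 i ∈ ({0, 1} : Set ℝ)) ∧ (∀ j, x.2.2 j ∈ ({0, 1} : Set ℝ)) ∧
      |x.1| ≤ W₁ + ∑ i, (M - u i) * (1 - x.2.1 i) ∧
      |x.1| ≤ W₂ + ∑ j, (M - v j) * (1 - x.2.2 j) ∧
      |x.1| ≤ M})
    (F : Fin (p + q + 1) → ℝ × (Fin p → ℝ) × (Fin q → ℝ))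
    (hF : F = Fin.cons ((W₁, fun _ => 1, fun _ => 1) :
        ℝ × (Fin p → ℝ) × (Fin q → ℝ))
      (Fin.append
        (fun k : Fin p =>
          ((W₂, (fun _ => 1) - Pi.single k 1, fun _ => 1) :
            ℝ × (Fin p → ℝ) × (Fin q → ℝ)))
        (fun ℓ : Fin q =>
          ((M, (fun _ => 1) - Pi.single (⟨0, hp⟩ : Fin p) 1,
              (fun _ => 1) - Pi.single ℓ 1) :
            ℝ × (Fin p → ℝ) × (Fin q → ℝ))))) :
    (∀ m, F m ∈ R ∧
      (F m).1 = W₁ + ((p : ℝ) - ∑ i, (F m).2.1 i) * (W₂ - W₁)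
        + ((q : ℝ) - ∑ j, (F m).2.2 j) * (M - W₂)) ∧
    AffineIndependent ℝ F := by
  subst hR
  have hu_le : ∀ k, u k ≤ W₁ := fun k => hW₁ ▸
    Finset.single_le_sum (fun i _ => (hu i).le) (Finset.mem_univ k)
  have hv_le : ∀ ℓ, v ℓ ≤ W₂ := fun ℓ => hW₂ ▸
    Finset.single_le_sum (fun j _ => (hv j).le) (Finset.mem_univ ℓ)
  have hW₁_pos : 0 < W₁ := (hu ⟨0, hp⟩).trans_le (hu_le _)
  have hW₂_pos : 0 < W₂ := hW₁_pos.trans hWW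
  have hM_pos : 0 < M := hW₂_pos.trans hWM
  have mem_zero_one : ∀ {n : ℕ} (k i : Fin n),
      ((fun _ => 1) - Pi.single k 1 : Fin n → ℝ) i ∈ ({0, 1} : Set ℝ) := by
    intro n k i
    by_cases h : i = k <;> simp [h]
  have F_zero : F 0 = (W₁, fun _ => 1, fun _ => 1) := by rw [hF]; rfl
  have F_left : ∀ k : Fin p, F (Fin.castAdd q k).succ =
      (W₂, (fun _ => 1) - Pi.single k 1, fun _ => 1) := by
    intro k; rw [hF, Fin.cons_succ, Fin.append_left]
  have F_right : ∀ ℓ : Fin q, F (Fin.natAdd p ℓ).succ =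
      (M, (fun _ => 1) - Pi.single (⟨0, hp⟩ : Fin p) 1, (fun _ => 1) - Pi.single ℓ 1) := by
    intro ℓ; rw [hF, Fin.cons_succ, Fin.append_right]
  clear hF
  constructor
  · intro m
    refine Fin.cases ?_ (fun m => Fin.addCases (fun k => ?_) (fun ℓ => ?_) m) m
    · rw [F_zero]
      simp [abs_of_pos hW₁_pos, hWW.le, (hWW.trans hWM).le]
    · rw [F_left]
      refine ⟨⟨mem_zero_one k, by simp, ?_⟩, ?_⟩
      · simp [abs_of_pos hW₂_pos, hWM.le, Pi.single_apply]
        linarith [hu_le k]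
      · simp
    · rw [F_right]
      refine ⟨⟨mem_zero_one _, mem_zero_one ℓ, ?_⟩, ?_⟩
      · simp [abs_of_pos hM_pos, Pi.single_apply]
        constructor <;> linarith [hu_le ⟨0, hp⟩, hv_le ℓ]
      · simp
  · rw [affineIndependent_iff_of_fintype]
    intro w hw hsum
    rw [Finset.weightedVSub_eq_linear_combination _ hw] at hsum
    rw [Fin.sum_univ_succ, Fin.sum_univ_add] at hw hsum
    simp only [F_zero, F_left, F_right] at hsum
    have right_zero : ∀ ℓ : Fin q, w (Fin.natAdd p ℓ).succ = 0 := by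
      intro ℓ
      have h := congrArg (fun x => x.2.2 ℓ) hsum
      simp [Prod.snd_sum, Finset.sum_apply, Pi.single_apply, mul_sub] at h
      linarith
    have left_zero : ∀ k : Fin p, w (Fin.castAdd q k).succ = 0 := by
      intro k
      have h := congrArg (fun x => x.2.1 k) hsum
      simp [Prod.snd_sum, Prod.fst_sum, Finset.sum_apply, Pi.single_apply, mul_sub,
        right_zero] at h hw
      linarith
    have head_zero : w 0 = 0 := by simpa [left_zero, right_zero] using hw
    exact Fin.cases head_zero (Fin.addCases left_zero right_zero)
end

section
/- Ideality of the conjunction (AND) encoding: for any natural number p ≥ 1, the polytope { (a, z) : (Fin p → ℝ) × ℝ | (∀ i, 0 ≤ a i ∧ a i ≤ 1) ∧ (∀ i, z ≤ a i) ∧ z ≥ (∑ i, a i) - p + 1 ∧ 0 ≤ z ∧ z ≤ 1 } equals convexHull ℝ { (a, ∏ i, a i) | ∀ i, a i ∈ ({0,1} : Set ℝ) }. -/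
open Set in
/-- A cube point with a vanishing coordinate, at height `0`, is a convex combination of points of the
graph of the product over the binary cube. -/
theorem mem_convexHull_graph_prod_of_eq_zero {ι : Type*} [Fintype ι] {t : ι → ℝ}
    (ht : ∀ j, t j ∈ Icc (0 : ℝ) 1) {i : ι} (hi : t i = 0) :
    (t, (0 : ℝ)) ∈ convexHull ℝ {x : (ι → ℝ) × ℝ | ∃ a : ι → ℝ,
      (∀ i, a i ∈ ({0, 1} : Set ℝ)) ∧ x = (a, ∏ i, a i)} := by
  classical
  let F : ι → Set ℝ := fun j => if j = i then {0} else {0, 1}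
  refine convexHull_mono (s := univ.pi F ×ˢ {0}) ?_ ?_
  · rintro ⟨a, z⟩ ⟨ha, hz⟩
    have ha' : ∀ j, a j ∈ F j := fun j => ha j (mem_univ j)
    refine ⟨a, fun j => ?_, ?_⟩
    · have := ha' j
      by_cases hj : j = i <;> simp_all [F]
    · have h0 : a i = 0 := by simpa [F] using ha' i
      rw [Finset.prod_eq_zero (Finset.mem_univ i) h0]
      simpa using hz
  · rw [convexHull_prod, convexHull_pi, convexHull_singleton]
    refine ⟨fun j _ => ?_, rfl⟩
    by_cases hj : j = i
    · simp [F, hj, hi]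
    · simpa [F, hj, convexHull_pair, segment_eq_Icc] using ht j

open Set in
/-- A cube point whose coordinates have total deficit at least `1`, at height `0`, is a convex
combination of points of the graph of the product over the binary cube. -/
theorem mem_convexHull_graph_prod_of_one_le_sum {ι : Type*} [Fintype ι] {b : ι → ℝ}
    (hb : ∀ j, b j ∈ Icc (0 : ℝ) 1) (hsum : 1 ≤ ∑ j, (1 - b j)) :
    (b, (0 : ℝ)) ∈ convexHull ℝ {x : (ι → ℝ) × ℝ | ∃ a : ι → ℝ,
      (∀ i, a i ∈ ({0, 1} : Set ℝ)) ∧ x = (a, ∏ i, a i)} := by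
  classical
  set S := ∑ j, (1 - b j) with hS
  have hS0 : 0 < S := by linarith
  let d : ι → ℝ := fun j => (1 - b j) / S
  have hd0 : ∀ j, 0 ≤ d j := fun j => div_nonneg (by linarith [(hb j).2]) hS0.le
  have hd1 : ∀ j, d j ≤ 1 - b j := fun j => div_le_self (by linarith [(hb j).2]) hsum
  have hd : ∑ j, d j = 1 := by
    rw [← Finset.sum_div, ← hS, div_self hS0.ne']
  let t : ι → ℝ := fun j => b j / (1 - d j)
  have ht : ∀ j, t j ∈ Icc (0 : ℝ) 1 := fun j =>
    ⟨div_nonneg (hb j).1 (by linarith [(hb j).1, hd1 j]),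
      div_le_one_of_le₀ (by linarith [hd1 j]) (by linarith [(hb j).1, hd1 j])⟩
  have hbt : ∀ j, (1 - d j) * t j = b j := fun j =>
    mul_div_cancel_of_imp' fun h => by linarith [(hb j).1, hd1 j]
  have hcomb : ∑ i, d i • (Function.update t i 0, (0 : ℝ)) = (b, (0 : ℝ)) := by
    refine Prod.ext (funext fun j => ?_) (by simp [Prod.snd_sum])
    have hterm : ∀ i, d i * Function.update t i 0 j
        = d i * t j - if i = j then d i * t j else 0 := by
      intro i
      by_cases h : i = j
      · subst h; simp
      · simp [h, Function.update_of_ne (Ne.symm h)]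
    simp only [Prod.fst_sum, Prod.smul_fst, Finset.sum_apply, Pi.smul_apply, smul_eq_mul, hterm,
      Finset.sum_sub_distrib, ← Finset.sum_mul, hd, Finset.sum_ite_eq', Finset.mem_univ, if_true]
    linarith [hbt j]
  rw [← hcomb]
  refine (convex_convexHull ℝ _).sum_mem (fun i _ => hd0 i) hd fun i _ => ?_
  refine mem_convexHull_graph_prod_of_eq_zero (i := i) (fun j => ?_) (by simp)
  by_cases h : j = i
  · subst h; simp
  · simpa [h] using ht j

/-- **Ideality of the conjunction (AND) encoding.**
The LP relaxation of the AND constraint equals the convex hull of the graph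
of the logical AND (the product ∏ i, a i) over {0,1}^p. -/
theorem and_encoding_ideal (p : ℕ) (hp : 1 ≤ p) :
    {x : (Fin p → ℝ) × ℝ |
      (∀ i, 0 ≤ x.1 i ∧ x.1 i ≤ 1) ∧ (∀ i, x.2 ≤ x.1 i) ∧
      (∑ i, x.1 i) - (p : ℝ) + 1 ≤ x.2 ∧ 0 ≤ x.2 ∧ x.2 ≤ 1} =
    convexHull ℝ {x : (Fin p → ℝ) × ℝ | ∃ a : Fin p → ℝ,
      (∀ i, a i ∈ ({0, 1} : Set ℝ)) ∧ x = (a, ∏ i, a i)} := by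
  have hdef : ∀ a : Fin p → ℝ, ∑ i, (1 - a i) = p - ∑ i, a i := fun a => by simp
  apply Set.Subset.antisymm
  · rintro ⟨a, z⟩ ⟨ha, hza, hs, hz0, hz1⟩
    dsimp only at ha hza hs hz0 hz1
    have hone : ((fun _ => 1, 1) : (Fin p → ℝ) × ℝ) ∈ convexHull ℝ {x : (Fin p → ℝ) × ℝ |
        ∃ a : Fin p → ℝ, (∀ i, a i ∈ ({0, 1} : Set ℝ)) ∧ x = (a, ∏ i, a i)} :=
      subset_convexHull ℝ _ ⟨fun _ => 1, by simp, by simp⟩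
    rcases hz1.eq_or_lt with rfl | hlt
    · have : a = fun _ => 1 := funext fun i => le_antisymm (ha i).2 (hza i)
      rwa [this]
    have hpos : 0 < 1 - z := by linarith
    let b : Fin p → ℝ := fun i => (a i - z) / (1 - z)
    have hb : ∀ i, b i ∈ Set.Icc (0 : ℝ) 1 := fun i =>
      ⟨div_nonneg (by linarith [hza i]) hpos.le,
        div_le_one_of_le₀ (by linarith [(ha i).2]) hpos.le⟩
    have hbs : 1 ≤ ∑ i, (1 - b i) := by
      have : ∀ i, 1 - b i = (1 - a i) / (1 - z) := fun i => by
        simp only [b]; field_simp; ring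
      simp only [this]
      rw [← Finset.sum_div, hdef, one_le_div hpos]
      linarith
    have hcomb : z • ((fun _ => 1, 1) : (Fin p → ℝ) × ℝ) + (1 - z) • (b, (0 : ℝ)) = (a, z) := by
      refine Prod.ext (funext fun i => ?_) (by simp)
      simp only [Prod.fst_add, Prod.smul_fst, Pi.add_apply, Pi.smul_apply, smul_eq_mul, b]
      field_simp
      ring
    rw [← hcomb]
    exact convex_convexHull ℝ _ hone (mem_convexHull_graph_prod_of_one_le_sum hb hbs)
      hz0 hpos.le (by ring)
  · refine convexHull_min ?_ ?_
    · rintro _ ⟨a, ha, rfl⟩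
      have ha01 : ∀ i, 0 ≤ a i ∧ a i ≤ 1 := fun i => by
        rcases ha i with h | h <;> rw [h] <;> norm_num
      by_cases h : ∃ i, a i = 0
      · obtain ⟨i, hi⟩ := h
        have hprod : ∏ i, a i = 0 := Finset.prod_eq_zero (Finset.mem_univ i) hi
        have hle : 1 - a i ≤ ∑ i, (1 - a i) :=
          Finset.single_le_sum (f := fun i => 1 - a i)
            (fun j _ => by linarith [(ha01 j).2]) (Finset.mem_univ i)
        rw [hdef, hi] at hle
        simp only [Set.mem_ofPred_eq, hprod]
        exact ⟨ha01, fun j => (ha01 j).1, by linarith, le_rfl, zero_le_one⟩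
      · have : a = fun _ => 1 := funext fun i => (ha i).resolve_left fun h0 => h ⟨i, h0⟩
        simp [this]
    · rintro ⟨a, z⟩ ⟨ha, hza, hs, hz0, hz1⟩ ⟨b, w⟩ ⟨hb, hwb, hs', hw0, hw1⟩ u v hu hv huv
      dsimp only at ha hza hs hz0 hz1 hb hwb hs' hw0 hw1
      obtain rfl : v = 1 - u := by linarith
      simp only [Set.mem_ofPred_eq, Prod.fst_add, Prod.snd_add, Prod.smul_fst, Prod.smul_snd,
        Pi.add_apply, Pi.smul_apply, smul_eq_mul, Finset.sum_add_distrib, ← Finset.mul_sum]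
      refine ⟨fun i => ⟨?_, ?_⟩, fun i => ?_, ?_, ?_, ?_⟩
      · nlinarith [(ha i).1, (hb i).1]
      · nlinarith [(ha i).2, (hb i).2]
      · nlinarith [hza i, hwb i]
      · nlinarith
      · nlinarith
      · nlinarith
end
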